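/- arXiv:1511.05767 — 2 statements merged into one kernel-verified Lean document; each statement's English description precedes it below -/
import Mathlib

section
/- Let n ≥ 3. Assume k ∈ SL(n,ℤ), δ ≥ ε > 0, p₁, p₂, p₃ are rational points of ℙ and L₁, L₂, L₃ are rational projective hyperplanes such that: for all 1 ≤ i ≠ j ≤ 3, p_i ∈ L_i and [p_i]_ε ∩ [L_j]_δ = ∅; and p₂ = k • p₁, p₃ = k² • p₁, L₂ = k • L₁, L₃ ≠ k² • L₁. Let 𝒜 = [p₁]_ε ∪ [p₂]_ε ∪ [p₃]_ε and ℛ = [L₁]_δ ∪ [L₂]_δ ∪ [L₃]_δ. Then there exists a Schottky system (S, 𝒜, ℛ) such that the subgroup H generated by S is profinitely dense, H ∩ kHk⁻¹ ≠ {id}, and the subgroup generated by S ∪ {k} is all of SL(n,ℤ). -/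
/- Common setup: `SL(n,ℤ)`, `SL(n,ℝ)`, the real projective space `ℙ^{n-1}(ℝ)`
with its quotient topology and the projective action, rank-1 unipotent elements
and their attracting points / fixed hyperplanes, metrics compatible with the
topology of `ℙ`, `ε`-neighbourhoods, Schottky systems, profinite density,
maximal subgroups, and lattices in `SL(n,ℝ)`. -/

open Matrix LinearAlgebra.Projectivization

abbrev SLZ (n : ℕ) := Matrix.SpecialLinearGroup (Fin n) ℤ

abbrev SLR (n : ℕ) := Matrix.SpecialLinearGroup (Fin n) ℝ

/-- The real projective space `ℙ^{n-1}(ℝ)`: the projectivization of `ℝⁿ`. -/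
abbrev Proj (n : ℕ) := Projectivization ℝ (Fin n → ℝ)

/-- The quotient topology on `ℙ^{n-1}(ℝ)`. -/
noncomputable instance (n : ℕ) : TopologicalSpace (Proj n) :=
  inferInstanceAs (TopologicalSpace (Quotient _))

/-- The action of `SL(n,ℝ)` on `ℙ^{n-1}(ℝ)` induced by the linear action on `ℝⁿ`. -/
noncomputable def actR {n : ℕ} (g : SLR n) (x : Proj n) : Proj n :=
  Projectivization.map (Matrix.SpecialLinearGroup.toLin' g).toLinearMap
    (Matrix.SpecialLinearGroup.toLin' g).injective x

/-- The action of `SL(n,ℤ)` on `ℙ^{n-1}(ℝ)` induced by the linear action on `ℝⁿ`. -/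
noncomputable def act {n : ℕ} (g : SLZ n) (x : Proj n) : Proj n :=
  actR (Matrix.SpecialLinearGroup.map (Int.castRingHom ℝ) g) x

/-- The real matrix attached to `g ∈ SL(n,ℤ)`. -/
noncomputable def matR {n : ℕ} (g : SLZ n) : Matrix (Fin n) (Fin n) ℝ :=
  ((Matrix.SpecialLinearGroup.map (Int.castRingHom ℝ)) g : Matrix (Fin n) (Fin n) ℝ)

/-- The subspace `Im(u - I) ⊆ ℝⁿ` (a line when `u` is rank-1 unipotent). -/
noncomputable def lineOf {n : ℕ} (u : SLZ n) : Submodule ℝ (Fin n → ℝ) :=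
  LinearMap.range (Matrix.mulVecLin (matR u - 1))

/-- The subspace `ker(u - I) ⊆ ℝⁿ` (a hyperplane when `u` is rank-1 unipotent). -/
noncomputable def hypOf {n : ℕ} (u : SLZ n) : Submodule ℝ (Fin n → ℝ) :=
  LinearMap.ker (Matrix.mulVecLin (matR u - 1))

/-- The rational matrix attached to `g ∈ SL(n,ℤ)`. -/
noncomputable def matQ {n : ℕ} (g : SLZ n) : Matrix (Fin n) (Fin n) ℚ :=
  ((Matrix.SpecialLinearGroup.map (Int.castRingHom ℚ)) g : Matrix (Fin n) (Fin n) ℚ)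

/-- `g - I`, as a `ℚ`-linear endomorphism of `ℚⁿ`. -/
noncomputable def linQ {n : ℕ} (g : SLZ n) : (Fin n → ℚ) →ₗ[ℚ] (Fin n → ℚ) :=
  Matrix.mulVecLin (matQ g - 1)

/-- `u` is a rank-1 unipotent element of `SL(n,ℤ)`: `u - I` is nilpotent of rank one. -/
def IsR1U {n : ℕ} (u : SLZ n) : Prop :=
  IsNilpotent (linQ u) ∧ Module.finrank ℚ (LinearMap.range (linQ u)) = 1

/-- The point of attraction `p_u` of `u`, as a subset of `ℙ` (a singleton when `u` is a
rank-1 unipotent): the projective points whose representative spans `Im(u - I)`. -/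
def attSet {n : ℕ} (u : SLZ n) : Set (Proj n) :=
  {x | x.submodule = lineOf u}

/-- The fixed hyperplane `L_u` of `u`, as a subset of `ℙ`. -/
def fixSet {n : ℕ} (u : SLZ n) : Set (Proj n) :=
  {x | x.submodule ≤ hypOf u}

/-- The subset of `ℙ` corresponding to a linear subspace `W ⊆ ℝⁿ`. -/
def projSet {n : ℕ} (W : Submodule ℝ (Fin n → ℝ)) : Set (Proj n) :=
  {x | x.submodule ≤ W}

/-- The image `g • W` of a subspace of `ℝⁿ` under `g ∈ SL(n,ℤ)`. -/
noncomputable def actSub {n : ℕ} (g : SLZ n) (W : Submodule ℝ (Fin n → ℝ)) :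
    Submodule ℝ (Fin n → ℝ) :=
  Submodule.map (Matrix.mulVecLin (matR g)) W

/-- The image `g • W` of a subspace of `ℝⁿ` under `g ∈ SL(n,ℝ)`. -/
noncomputable def actSubR {n : ℕ} (g : SLR n) (W : Submodule ℝ (Fin n → ℝ)) :
    Submodule ℝ (Fin n → ℝ) :=
  Submodule.map (Matrix.mulVecLin (g : Matrix (Fin n) (Fin n) ℝ)) W

/-- `d` is a metric on `ℙ^{n-1}(ℝ)` inducing the quotient topology. -/
structure IsCompatMetric {n : ℕ} (d : Proj n → Proj n → ℝ) : Prop where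
  self : ∀ x, d x x = 0
  eq_of : ∀ x y, d x y = 0 → x = y
  symm : ∀ x y, d x y = d y x
  triangle : ∀ x y z, d x z ≤ d x y + d y z
  inducing : ∀ s : Set (Proj n), IsOpen s ↔ ∀ x ∈ s, ∃ ε > 0, ∀ y, d x y < ε → y ∈ s

/-- The distance from a point to a set. -/
noncomputable def setDist {n : ℕ} (d : Proj n → Proj n → ℝ) (x : Proj n)
    (A : Set (Proj n)) : ℝ :=
  sInf (d x '' A)

/-- The open `ε`-neighbourhood `(A)_ε = {x | dist(x, A) < ε}`. -/
def oThick {n : ℕ} (d : Proj n → Proj n → ℝ) (A : Set (Proj n)) (ε : ℝ) : Set (Proj n) :=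
  {x | setDist d x A < ε}

/-- The closed `ε`-neighbourhood `[A]_ε = {x | dist(x, A) ≤ ε}`. -/
def cThick {n : ℕ} (d : Proj n → Proj n → ℝ) (A : Set (Proj n)) (ε : ℝ) : Set (Proj n) :=
  {x | setDist d x A ≤ ε}

/-- The Hausdorff distance between two subsets of `ℙ`. -/
noncomputable def hDist {n : ℕ} (d : Proj n → Proj n → ℝ) (A B : Set (Proj n)) : ℝ :=
  max (sSup ((fun a => setDist d a B) '' A)) (sSup ((fun b => setDist d b A) '' B))

/-- A rational point of `ℙ`: one spanned by a vector of `ℚⁿ`. -/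
def RatPoint {n : ℕ} (p : Proj n) : Prop :=
  ∃ v : Fin n → ℚ, p.submodule = Submodule.span ℝ {fun i => ((v i : ℝ))}

/-- A subspace of `ℝⁿ` spanned by vectors of `ℚⁿ`. -/
def IsRatSubmodule {n : ℕ} (W : Submodule ℝ (Fin n → ℝ)) : Prop :=
  ∃ T : Set (Fin n → ℚ),
    W = Submodule.span ℝ ((fun (v : Fin n → ℚ) (i : Fin n) => ((v i : ℝ))) '' T)

/-- A Schottky system `(S, 𝒜, ℛ)` with respect to the metric `d`: `S` is a nonempty
set of rank-1 unipotents, `𝒜 ⊆ ℛ` are closed, and for each `u ∈ S` there are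
`δ_u ≥ ε_u > 0` satisfying the ping-pong conditions. -/
structure IsSchottky {n : ℕ} (d : Proj n → Proj n → ℝ) (S : Set (SLZ n))
    (A R : Set (Proj n)) : Prop where
  nonempty : S.Nonempty
  unip : ∀ u ∈ S, IsR1U u
  AsubR : A ⊆ R
  closedA : IsClosed A
  closedR : IsClosed R
  cond : ∃ ε δ : SLZ n → ℝ, (∀ u ∈ S, 0 < ε u ∧ ε u ≤ δ u) ∧
    (∀ u ∈ S, ∀ k : ℤ, k ≠ 0 → ∀ x, x ∉ oThick d (fixSet u) (δ u) →
      act (u ^ k) x ∈ oThick d (attSet u) (ε u)) ∧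
    (∀ u ∈ S, ∀ v ∈ S, u ≠ v → oThick d (attSet u) (ε u) ∩ oThick d (fixSet v) (δ v) = ∅) ∧
    (∀ u ∈ S, oThick d (attSet u) (ε u) ⊆ A) ∧
    (∀ u ∈ S, oThick d (fixSet u) (δ u) ⊆ R)

/-- `H` is profinitely dense in `G`: `HN = G` for every finite-index normal `N ⊴ G`. -/
def ProfinitelyDense {G : Type*} [Group G] (H : Subgroup G) : Prop :=
  ∀ N : Subgroup G, N.Normal → N.FiniteIndex → H ⊔ N = ⊤

/-- `M` is a maximal (proper) subgroup of `G`. -/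
def IsMaxSubgroup {G : Type*} [Group G] (M : Subgroup G) : Prop :=
  M ≠ ⊤ ∧ ∀ K : Subgroup G, M < K → K = ⊤

noncomputable instance (n : ℕ) : TopologicalSpace (SLR n) :=
  inferInstanceAs (TopologicalSpace {A : Matrix (Fin n) (Fin n) ℝ // A.det = 1})

noncomputable instance (n : ℕ) : MeasurableSpace (SLR n) := borel _

/-- `Γ ≤ SL(n,ℝ)` is a lattice: a discrete subgroup admitting a Borel fundamental
domain of finite Haar measure. -/
def IsLatticeIn {n : ℕ} (Γ : Subgroup (SLR n)) : Prop :=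
  DiscreteTopology Γ ∧
  ∃ μ : MeasureTheory.Measure (SLR n), μ.IsHaarMeasure ∧
    ∃ D : Set (SLR n), MeasurableSet D ∧ μ D < ⊤ ∧
      ∀ g : SLR n, ∃! γ : Γ, (γ : SLR n)⁻¹ * g ∈ D

section Transvections

variable {n : ℕ}

lemma SLZ.coe_mul (g h : SLZ n) : (g * h).1 = g.1 * h.1 := rfl

lemma SLZ.coe_one : (1 : SLZ n).1 = 1 := rfl

/-- The transvection `v ↦ v + φ(v) x` of `ℤⁿ`, with the junk value `1` when `φ(x) ≠ 0`. -/
def tv (x φ : Fin n → ℤ) : SLZ n :=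
  if h : φ ⬝ᵥ x = 0 then ⟨1 + vecMulVec x φ, by
    rw [vecMulVec_eq Unit, det_one_add_replicateCol_mul_replicateRow, h, add_zero]⟩ else 1

lemma tv_coe {x φ : Fin n → ℤ} (h : φ ⬝ᵥ x = 0) :
    (tv x φ).1 = 1 + vecMulVec x φ := by
  simp [-zsmul_eq_mul, tv, h]

lemma eq_tv {x φ : Fin n → ℤ} (h : φ ⬝ᵥ x = 0) {g : SLZ n}
    (hg : g.1 = 1 + vecMulVec x φ) : g = tv x φ :=
  Subtype.ext (hg.trans (tv_coe h).symm)

lemma tv_zero_left (φ : Fin n → ℤ) : tv 0 φ = 1 :=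
  (eq_tv (by simp [-zsmul_eq_mul]) (by simp [-zsmul_eq_mul])).symm

lemma tv_mul_left {x y φ : Fin n → ℤ} (hx : φ ⬝ᵥ x = 0) (hy : φ ⬝ᵥ y = 0) :
    tv x φ * tv y φ = tv (x + y) φ := by
  refine eq_tv (by simp [-zsmul_eq_mul, dotProduct_add, hx, hy]) ?_
  rw [SLZ.coe_mul, tv_coe hx, tv_coe hy, add_mul, mul_add, mul_add,
    vecMulVec_mul_vecMulVec, hy, add_vecMulVec]
  simp only [mul_one, one_mul, zero_smul, vecMulVec_zero, add_zero]
  abel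

lemma tv_mul_right {x φ ψ : Fin n → ℤ} (hx : φ ⬝ᵥ x = 0) (hy : ψ ⬝ᵥ x = 0) :
    tv x φ * tv x ψ = tv x (φ + ψ) := by
  refine eq_tv (by simp [-zsmul_eq_mul, add_dotProduct, hx, hy]) ?_
  rw [SLZ.coe_mul, tv_coe hx, tv_coe hy, add_mul, mul_add, mul_add,
    vecMulVec_mul_vecMulVec, hx, vecMulVec_add]
  simp only [mul_one, one_mul, zero_smul, vecMulVec_zero, add_zero]
  abel

lemma tv_smul (c : ℤ) (x φ : Fin n → ℤ) (h : φ ⬝ᵥ x = 0) : tv (c • x) φ = tv x (c • φ) := by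
  refine eq_tv (by simp [-zsmul_eq_mul, h]) ?_
  rw [tv_coe (by simp [-zsmul_eq_mul, h]), smul_vecMulVec, vecMulVec_smul]

lemma tv_inv {x φ : Fin n → ℤ} (h : φ ⬝ᵥ x = 0) : (tv x φ)⁻¹ = tv (-x) φ := by
  apply inv_eq_of_mul_eq_one_right
  rw [tv_mul_left h (by simp [-zsmul_eq_mul, h]), add_neg_cancel, tv_zero_left]

lemma tv_zpow {x φ : Fin n → ℤ} (h : φ ⬝ᵥ x = 0) (k : ℤ) : tv x φ ^ k = tv (k • x) φ := by
  induction k with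
  | zero => simp [tv_zero_left]
  | succ i ih => rw [_root_.zpow_add_one, ih, tv_mul_left (by rw [dotProduct_smul, h, smul_zero]) h,
      add_smul, one_smul]
  | pred i ih =>
    rw [_root_.zpow_sub_one, ih, tv_inv h, tv_mul_left (by rw [dotProduct_smul, h, smul_zero])
      (by simp [h]), sub_smul, one_smul,
      sub_eq_add_neg]

lemma vecMul_inv_dotProduct_mulVec (g : SLZ n) (x φ : Fin n → ℤ) :
    (φ ᵥ* (g⁻¹ : SLZ n).1) ⬝ᵥ (g.1 *ᵥ x) = φ ⬝ᵥ x := by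
  rw [dotProduct_mulVec, vecMul_vecMul, ← SLZ.coe_mul, inv_mul_cancel,
    SLZ.coe_one, vecMul_one]

lemma tv_conj (g : SLZ n) {x φ : Fin n → ℤ} (h : φ ⬝ᵥ x = 0) :
    g * tv x φ * g⁻¹ = tv (g.1 *ᵥ x) (φ ᵥ* (g⁻¹ : SLZ n).1) := by
  refine eq_tv ((vecMul_inv_dotProduct_mulVec g x φ).trans h) ?_
  rw [SLZ.coe_mul, SLZ.coe_mul, tv_coe h, mul_add, add_mul, mul_one,
    mul_vecMulVec, vecMulVec_mul, ← SLZ.coe_mul, mul_inv_cancel,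
    SLZ.coe_one]

lemma tv_mulVec {x φ : Fin n → ℤ} (h : φ ⬝ᵥ x = 0) (y : Fin n → ℤ) :
    (tv x φ).1 *ᵥ y = y + (φ ⬝ᵥ y) • x := by
  rw [tv_coe h, add_mulVec, one_mulVec, vecMulVec_mulVec]
  ext i; simp [mul_comm]

lemma vecMul_tv {x φ : Fin n → ℤ} (h : φ ⬝ᵥ x = 0) (ψ : Fin n → ℤ) :
    ψ ᵥ* (tv x φ).1 = ψ + (ψ ⬝ᵥ x) • φ := by
  rw [tv_coe h, vecMul_add, vecMul_one, vecMul_vecMulVec]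

/-- The `i`-th standard basis vector of `ℤⁿ`, also used as the `i`-th coordinate functional. -/
abbrev stdv (i : Fin n) : Fin n → ℤ := Pi.single i 1

lemma stdv_dot {a b : Fin n} (h : a ≠ b) : stdv b ⬝ᵥ stdv a = 0 := by
  simp [-zsmul_eq_mul, h]

/-- The subgroup of `SL(n,ℤ)` generated by the `q`-th powers of the elementary matrices. -/
def elemPow (n : ℕ) (q : ℤ) : Subgroup (SLZ n) :=
  Subgroup.closure {g | ∃ a b : Fin n, a ≠ b ∧ g = tv (q • stdv a) (stdv b)}

lemma tv_stdv_mem_elemPow (q : ℤ) {a b : Fin n} (h : a ≠ b) :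
    tv (q • stdv a) (stdv b) ∈ elemPow n q :=
  Subgroup.subset_closure ⟨a, b, h, rfl⟩

lemma tv_stdv_right_mem_elemPow {q : ℤ} {l : Fin n} {x : Fin n → ℤ} (hx : x l = 0) :
    tv (q • x) (stdv l) ∈ elemPow n q := by
  let A : AddSubgroup (Fin n → ℤ) :=
    { carrier := {x | x l = 0 ∧ tv (q • x) (stdv l) ∈ elemPow n q}
      zero_mem' := by simp [-zsmul_eq_mul, tv_zero_left, one_mem]
      add_mem' := by
        rintro x y ⟨hx, hx'⟩ ⟨hy, hy'⟩
        refine ⟨by simp [-zsmul_eq_mul, hx, hy], ?_⟩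
        rw [smul_add, ← tv_mul_left (by simp [-zsmul_eq_mul, hx]) (by simp [-zsmul_eq_mul, hy])]
        exact mul_mem hx' hy'
      neg_mem' := by
        rintro x ⟨hx, hx'⟩
        refine ⟨by simp [-zsmul_eq_mul, hx], ?_⟩
        rw [smul_neg, ← tv_inv (by simp [-zsmul_eq_mul, hx])]
        exact inv_mem hx' }
  suffices x ∈ A from this.2
  rw [← Finset.univ_sum_single x]
  refine sum_mem fun i _ => ?_
  by_cases hi : i = l
  · subst hi; rw [hx, Pi.single_zero]; exact zero_mem A
  · have : (Pi.single i (x i) : Fin n → ℤ) = x i • stdv i := by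
      rw [← Pi.single_smul, smul_eq_mul, mul_one]
    rw [this]
    exact zsmul_mem (K := A) (show _ ∧ _ from ⟨by simp [hi], tv_stdv_mem_elemPow q hi⟩) _

lemma tv_stdv_left_mem_elemPow {q : ℤ} {l : Fin n} {φ : Fin n → ℤ} (hx : φ l = 0) :
    tv (q • stdv l) φ ∈ elemPow n q := by
  let A : AddSubgroup (Fin n → ℤ) :=
    { carrier := {φ | φ l = 0 ∧ tv (q • stdv l) φ ∈ elemPow n q}
      zero_mem' := by
        refine ⟨rfl, ?_⟩
        rw [show tv (q • stdv l) (0 : Fin n → ℤ) = 1 from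
          (eq_tv (by simp [-zsmul_eq_mul]) (by simp [-zsmul_eq_mul])).symm]
        exact one_mem _
      add_mem' := by
        rintro x y ⟨hx, hx'⟩ ⟨hy, hy'⟩
        refine ⟨by simp [-zsmul_eq_mul, hx, hy], ?_⟩
        rw [← tv_mul_right (by simp [-zsmul_eq_mul, hx]) (by simp [-zsmul_eq_mul, hy])]
        exact mul_mem hx' hy'
      neg_mem' := by
        rintro x ⟨hx, hx'⟩
        refine ⟨by simp [-zsmul_eq_mul, hx], ?_⟩
        have : tv (q • stdv l) (-x) = (tv (q • stdv l) x)⁻¹ := by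
          rw [tv_inv (by simp [-zsmul_eq_mul, hx]), ← neg_one_zsmul x,
            ← tv_smul _ _ _ (by simp [-zsmul_eq_mul, hx]), neg_one_zsmul]
        rw [this]
        exact inv_mem hx' }
  suffices φ ∈ A from this.2
  rw [← Finset.univ_sum_single φ]
  refine sum_mem fun i _ => ?_
  by_cases hi : i = l
  · subst hi; rw [hx, Pi.single_zero]; exact zero_mem A
  · have : (Pi.single i (φ i) : Fin n → ℤ) = φ i • stdv i := by
      rw [← Pi.single_smul, smul_eq_mul, mul_one]
    rw [this]
    exact zsmul_mem (K := A) (show _ ∧ _ from ⟨by simp [hi], tv_stdv_mem_elemPow q (Ne.symm hi)⟩) _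

lemma tv_commutator {x y φ ψ : Fin n → ℤ} (hx : ψ ⬝ᵥ x = 0) (hy : φ ⬝ᵥ y = 0)
    (hφx : φ ⬝ᵥ x = 0) :
    tv x ψ * tv y φ * (tv x ψ)⁻¹ * (tv y φ)⁻¹ = tv ((ψ ⬝ᵥ y) • x) φ := by
  rw [tv_conj _ hy, tv_mulVec hx, tv_inv hx, vecMul_tv (by simp [-zsmul_eq_mul, hx]),
    dotProduct_neg, hφx, neg_zero,
    zero_smul, add_zero, tv_inv hy, tv_mul_left (by simp [-zsmul_eq_mul, hy, hφx, dotProduct_add])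
    (by simp [-zsmul_eq_mul, hy])]
  congr 1; abel

lemma tv_mem_elemPow_of_common_zero {q : ℤ} {l : Fin n} {x φ : Fin n → ℤ} (h : φ ⬝ᵥ x = 0)
    (hx : x l = 0) (hφ : φ l = 0) : tv (q ^ 2 • x) φ ∈ elemPow n q := by
  have h1 := tv_stdv_right_mem_elemPow (q := q) hx
  have h2 := tv_stdv_left_mem_elemPow (q := q) hφ
  have := tv_commutator (x := q • x) (y := q • stdv l) (φ := φ) (ψ := stdv l)
    (by simp [-zsmul_eq_mul, hx]) (by simp [-zsmul_eq_mul, hφ]) (by simp [-zsmul_eq_mul, h])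
  have h3 : (stdv l ⬝ᵥ (q • stdv l)) • (q • x) = q ^ 2 • x := by
    simp [-zsmul_eq_mul, smul_smul, pow_two]
  rw [h3] at this
  rw [← this]
  exact mul_mem (mul_mem (mul_mem h1 h2) (inv_mem h1)) (inv_mem h2)

lemma tv_minor_mem_elemPow (hn : 3 ≤ n) (q : ℤ) (x : Fin n → ℤ) {i l : Fin n} (hil : i ≠ l) :
    tv (q ^ 2 • x) (x l • stdv i - x i • stdv l) ∈ elemPow n q := by
  set ψ : Fin n → ℤ := x l • stdv i - x i • stdv l with hψ
  set x' : Fin n → ℤ := x i • stdv i + x l • stdv l with hx'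
  have e1 : ψ ⬝ᵥ x' = 0 := by
    simp [-zsmul_eq_mul, hψ, hx', hil, hil.symm, dotProduct_add, mul_comm]
  have e0 : ψ ⬝ᵥ x = 0 := by simp [-zsmul_eq_mul, hψ, sub_dotProduct, mul_comm]
  have e2 : ψ ⬝ᵥ (x - x') = 0 := by rw [dotProduct_sub, e0, e1, sub_zero]
  have key : tv (q ^ 2 • x) ψ = tv (q ^ 2 • x') ψ * tv (q ^ 2 • (x - x')) ψ := by
    rw [tv_mul_left (by simp [-zsmul_eq_mul, e1]) (by simp [-zsmul_eq_mul, e2]),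
      ← smul_add, add_sub_cancel]
  rw [key]
  refine mul_mem ?_ ?_
  · obtain ⟨h, hh⟩ : ∃ h : Fin n, h ∉ ({i, l} : Finset (Fin n)) := by
      by_contra! hc
      have := Finset.card_le_card (fun a _ => hc a : Finset.univ ⊆ ({i, l} : Finset (Fin n)))
      have h2 := Finset.card_le_two (a := i) (b := l)
      simp only [Finset.card_univ, Fintype.card_fin] at this
      omega
    simp only [Finset.mem_insert, Finset.mem_singleton, not_or] at hh
    exact tv_mem_elemPow_of_common_zero e1 (l := h) (by simp [-zsmul_eq_mul, hx', hh.1, hh.2])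
      (by simp [-zsmul_eq_mul, hψ, hh.1, hh.2])
  · have zi : (x - x') i = 0 := by simp [-zsmul_eq_mul, hx', hil]
    have zl : (x - x') l = 0 := by simp [-zsmul_eq_mul, hx', hil.symm]
    have : tv (q ^ 2 • (x - x')) ψ = tv (q • ((q * x l) • (x - x'))) (stdv i) *
        tv (q • ((- q * x i) • (x - x'))) (stdv l) := by
      have di : stdv i ⬝ᵥ (q ^ 2 • (x - x')) = 0 := by
        rw [single_one_dotProduct, Pi.smul_apply, zi, smul_zero]
      have dl : stdv l ⬝ᵥ (q ^ 2 • (x - x')) = 0 := by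
        rw [single_one_dotProduct, Pi.smul_apply, zl, smul_zero]
      rw [smul_smul, smul_smul, show q * (q * x l) = x l * q ^ 2 by ring,
        show q * (-q * x i) = -x i * q ^ 2 by ring, mul_smul, mul_smul, tv_smul (x l) _ _ di,
        tv_smul (-x i) _ _ dl, tv_mul_right (by rw [smul_dotProduct, di, smul_zero])
          (by rw [smul_dotProduct, dl, smul_zero]), neg_smul, ← sub_eq_add_neg]
    rw [this]
    exact mul_mem (tv_stdv_right_mem_elemPow (by simp [-zsmul_eq_mul, -Pi.sub_apply, zi]))
      (tv_stdv_right_mem_elemPow (by simp [-zsmul_eq_mul, -Pi.sub_apply, zl]))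

lemma tv_zero_right (x : Fin n → ℤ) : tv x 0 = 1 :=
  (eq_tv (by simp) (by simp)).symm

/-- If `φ(x) = 0`, then all transvections along `(x, x_l φ)` with multiplier divisible by `q²` lie
in the group generated by the `q`-th powers of the elementary matrices. -/
lemma tv_coord_smul_mem_elemPow (hn : 3 ≤ n) (q t : ℤ) {x φ : Fin n → ℤ} (h : φ ⬝ᵥ x = 0)
    (l : Fin n) : tv ((q ^ 2 * t) • x) (x l • φ) ∈ elemPow n q := by
  have h0 : ∀ i, (x l • stdv i - x i • stdv l) ⬝ᵥ x = 0 := fun i => by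
    simp [-zsmul_eq_mul, sub_dotProduct, mul_comm]
  have hsum : x l • φ = ∑ i, φ i • (x l • stdv i - x i • stdv l) := by
    have h1 : ∑ i, φ i • x i • stdv l = (0 : Fin n → ℤ) := by
      have : ∑ i, φ i • x i • stdv l = (φ ⬝ᵥ x) • (stdv l : Fin n → ℤ) := by
        simp only [dotProduct, Finset.sum_smul, smul_smul]
      rw [this, h, zero_smul]
    simp only [smul_sub, Finset.sum_sub_distrib, h1, sub_zero]
    simp only [smul_comm _ (x l), ← Finset.smul_sum]
    congr 1
    ext j
    simp [-zsmul_eq_mul, Finset.sum_apply, Pi.single_apply]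
  let A : AddSubgroup (Fin n → ℤ) :=
    { carrier := {ψ | ψ ⬝ᵥ x = 0 ∧ tv (q ^ 2 • x) ψ ∈ elemPow n q}
      zero_mem' := ⟨zero_dotProduct x, by rw [tv_zero_right]; exact one_mem _⟩
      add_mem' := by
        rintro ψ χ ⟨hx, hx'⟩ ⟨hy, hy'⟩
        refine ⟨by simp [add_dotProduct, hx, hy], ?_⟩
        rw [← tv_mul_right (by rw [dotProduct_smul, hx, smul_zero])
          (by rw [dotProduct_smul, hy, smul_zero])]
        exact mul_mem hx' hy'
      neg_mem' := by
        rintro ψ ⟨hx, hx'⟩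
        refine ⟨by simp [hx], ?_⟩
        have : tv (q ^ 2 • x) (-ψ) = (tv (q ^ 2 • x) ψ)⁻¹ := by
          rw [tv_inv (by rw [dotProduct_smul, hx, smul_zero]), ← neg_one_zsmul ψ,
            ← tv_smul _ _ _ (by rw [dotProduct_smul, hx, smul_zero]), neg_one_zsmul]
        rw [this]
        exact inv_mem hx' }
  have hA : x l • φ ∈ A := by
    rw [hsum]
    refine sum_mem fun i _ => zsmul_mem (K := A) ?_ _
    by_cases hi : i = l
    · subst hi; rw [sub_self]; exact zero_mem A
    · exact show _ ∧ _ from ⟨h0 i, tv_minor_mem_elemPow hn q x hi⟩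
  have h2 := zsmul_mem hA t
  rw [mul_comm, mul_smul, tv_smul _ _ _ (by simp [-zsmul_eq_mul, h])]
  exact h2.2

lemma elemPow_le_of_normal {N : Subgroup (SLZ n)} [N.Normal] {r : ℕ} (hr : N.index = r) :
    elemPow n r ≤ N := by
  refine (Subgroup.closure_le _).2 ?_
  rintro _ ⟨a, b, hab, rfl⟩
  have : tv ((r : ℤ) • stdv a) (stdv b) = tv (stdv a) (stdv b) ^ r := by
    rw [← zpow_natCast, tv_zpow (stdv_dot hab)]
  rw [this, ← hr]
  exact Subgroup.pow_index_mem N _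

lemma dvd_sub_of_mem_elemPow {q : ℤ} {g : SLZ n} (hg : g ∈ elemPow n q) (y : Fin n → ℤ)
    (i : Fin n) : q ∣ (g.1 *ᵥ y) i - y i := by
  induction hg using Subgroup.closure_induction generalizing y with
  | mem g hg =>
    obtain ⟨a, b, hab, rfl⟩ := hg
    rw [tv_mulVec (by simp [-zsmul_eq_mul, hab]), Pi.add_apply, add_sub_cancel_left, Pi.smul_apply,
      Pi.smul_apply, smul_eq_mul, smul_eq_mul]
    exact Dvd.dvd.mul_left (dvd_mul_right _ _) _
  | one => simp
  | mul g h _ _ ihg ihh =>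
    rw [SLZ.coe_mul, ← mulVec_mulVec]
    have := dvd_add (ihg (h.1 *ᵥ y)) (ihh y)
    rwa [sub_add_sub_cancel] at this
  | inv g _ ih =>
    have := ih ((g⁻¹ : SLZ n).1 *ᵥ y)
    rw [mulVec_mulVec, ← SLZ.coe_mul, mul_inv_cancel, SLZ.coe_one, one_mulVec] at this
    rwa [← neg_sub, dvd_neg]

end Transvections

section Generation

variable {n : ℕ}

lemma stdv_apply_self (i : Fin n) : stdv i i = 1 := Pi.single_eq_same i 1

lemma stdv_apply_ne {i j : Fin n} (h : j ≠ i) : stdv i j = 0 := Pi.single_eq_of_ne h 1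

lemma tv_smul_stdv_mem_elemPow_one (c : ℤ) {a b : Fin n} (h : a ≠ b) :
    tv (c • stdv a) (stdv b) ∈ elemPow n 1 := by
  have := tv_stdv_right_mem_elemPow (q := 1) (l := b) (x := c • stdv a)
    (by simp [-zsmul_eq_mul, h.symm])
  rwa [one_smul] at this

lemma tv_smul_stdv_mulVec (c : ℤ) {a b : Fin n} (h : a ≠ b) (y : Fin n → ℤ) :
    (tv (c • stdv a) (stdv b)).1 *ᵥ y = y + (y b * c) • stdv a := by
  rw [tv_mulVec (by simp [-zsmul_eq_mul, h]), single_one_dotProduct, smul_smul]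

lemma eq_one_of_fix_stdv {g : SLZ n} (h : ∀ j, g.1 *ᵥ stdv j = stdv j) : g = 1 := by
  refine Subtype.ext (ext_of_mulVec_single fun j => ?_)
  rw [h j, SLZ.coe_one, one_mulVec]

/-- The induction step in the proof that elementary matrices generate `SL(n,ℤ)`: if the elements
fixing the basis vectors of index at least `m` lie in the elementary group, then so do those fixing
the basis vectors of larger index. -/
lemma mem_elemPow_one_step {m : Fin n}
    (ih : ∀ g : SLZ n, (∀ j, m ≤ j → g.1 *ᵥ stdv j = stdv j) → g ∈ elemPow n 1)
    (g : SLZ n) (hg : ∀ j, m < j → g.1 *ᵥ stdv j = stdv j) : g ∈ elemPow n 1 := by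
  have cancel : ∀ h g : SLZ n, h ∈ elemPow n 1 → h * g ∈ elemPow n 1 → g ∈ elemPow n 1 :=
    fun h g hh hgh => (Subgroup.mul_mem_cancel_left _ hh).1 hgh
  have fix : ∀ (g : SLZ n), (∀ j, m < j → g.1 *ᵥ stdv j = stdv j) → ∀ (c : ℤ) (a b : Fin n),
      a ≠ b → b ≤ m → ∀ j, m < j →
        (tv (c • stdv a) (stdv b) * g).1 *ᵥ stdv j = stdv j := by
    intro g hg c a b hab hb j hj
    rw [SLZ.coe_mul, ← mulVec_mulVec, hg j hj, tv_smul_stdv_mulVec c hab,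
      stdv_apply_ne (ne_of_lt (lt_of_le_of_lt hb hj)), zero_mul, zero_smul, add_zero]
  have caseOne : ∀ g : SLZ n, (∀ j, m < j → g.1 *ᵥ stdv j = stdv j) →
      (g.1 *ᵥ stdv m) m = 1 → g ∈ elemPow n 1 := by
    intro g hg hm
    set v := g.1 *ᵥ stdv m with hv
    have h0 : (stdv m : Fin n → ℤ) ⬝ᵥ (stdv m - v) = 0 := by
      rw [single_one_dotProduct, Pi.sub_apply, hm, stdv_apply_self, sub_self]
    have h1 := tv_stdv_right_mem_elemPow (q := 1) (l := m) (x := stdv m - v)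
      (by rw [Pi.sub_apply, hm, stdv_apply_self, sub_self])
    rw [one_smul] at h1
    refine cancel _ g h1 (ih _ fun j hj => ?_)
    rw [SLZ.coe_mul, ← mulVec_mulVec, tv_mulVec h0]
    rcases hj.eq_or_lt with rfl | hj
    · rw [← hv, single_one_dotProduct, hm, one_smul, add_sub_cancel]
    · rw [hg j hj, single_one_dotProduct, stdv_apply_ne hj.ne, zero_smul, add_zero]
  have caseUnit : ∀ g : SLZ n, (∀ j, m < j → g.1 *ᵥ stdv j = stdv j) → ∀ i < m,
      (g.1 *ᵥ stdv m) i * (g.1 *ᵥ stdv m) i = 1 → g ∈ elemPow n 1 := by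
    intro g hg i him hi
    refine cancel _ g (tv_smul_stdv_mem_elemPow_one
      ((g.1 *ᵥ stdv m) i * (1 - (g.1 *ᵥ stdv m) m)) him.ne')
      (caseOne _ (fix g hg _ _ _ him.ne' him.le) ?_)
    rw [SLZ.coe_mul, ← mulVec_mulVec, tv_smul_stdv_mulVec _ him.ne', ← mul_assoc, hi, one_mul]
    simp [-zsmul_eq_mul]
  generalize hN : ∑ i ∈ Finset.Iic m, ((g.1 *ᵥ stdv m) i).natAbs = N
  induction N using Nat.strong_induction_on generalizing g with
  | _ N IH =>
  set v := g.1 *ᵥ stdv m with hv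
  by_cases hc : ∃ i j, i ≤ m ∧ j ≤ m ∧ i ≠ j ∧ v i ≠ 0 ∧ (v i).natAbs ≤ (v j).natAbs
  · obtain ⟨i, j, hi, hj, hij, hvi, hle⟩ := hc
    have hmem := tv_smul_stdv_mem_elemPow_one (-(v j / v i)) hij.symm
    refine cancel _ g hmem (IH _ ?_ _ (fix g hg _ _ _ hij.symm hi) rfl)
    rw [← hN]
    have hv' : (tv (-(v j / v i) • stdv j) (stdv i) * g).1 *ᵥ stdv m =
        v + (v i * -(v j / v i)) • stdv j := by
      rw [SLZ.coe_mul, ← mulVec_mulVec, tv_smul_stdv_mulVec _ hij.symm]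
    rw [hv']
    refine Finset.sum_lt_sum ?_ ⟨j, by simpa using hj, ?_⟩
    · intro l _
      rcases eq_or_ne l j with rfl | hl
      · have : (v + (v i * -(v l / v i)) • stdv l) l = v l % v i := by
          simp [-zsmul_eq_mul, Int.emod_def]; ring
        rw [this]
        have h1 := Int.emod_nonneg (v l) hvi
        have h2 := Int.emod_lt_abs (v l) hvi
        rw [Int.abs_eq_natAbs] at h2
        omega
      · simp [-zsmul_eq_mul, hl]
    · have : (v + (v i * -(v j / v i)) • stdv j) j = v j % v i := by
        simp [-zsmul_eq_mul, Int.emod_def]; ring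
      rw [this]
      have h1 := Int.emod_nonneg (v j) hvi
      have h2 := Int.emod_lt_abs (v j) hvi
      rw [Int.abs_eq_natAbs] at h2
      omega
  · have hc' : ∀ i j, i ≤ m → j ≤ m → i ≠ j → v i ≠ 0 → v j = 0 := by
      intro i j hi hj hij hvi
      by_contra hvj
      rcases le_total (v i).natAbs (v j).natAbs with h | h
      · exact hc ⟨i, j, hi, hj, hij, hvi, h⟩
      · exact hc ⟨j, i, hj, hi, hij.symm, hvj, h⟩
    set w : Fin n → ℤ := stdv m ᵥ* (g⁻¹ : SLZ n).1 with hw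
    have hwv : w ⬝ᵥ v = 1 := by
      rw [hw, hv, vecMul_inv_dotProduct_mulVec, single_one_dotProduct, stdv_apply_self]
    have hw0 : ∀ i, m < i → w i = 0 := by
      intro i hi
      have : w ⬝ᵥ (g.1 *ᵥ stdv i) = 0 := by
        rw [hw, vecMul_inv_dotProduct_mulVec, single_one_dotProduct, stdv_apply_ne hi.ne]
      rwa [hg i hi, dotProduct_single_one] at this
    obtain ⟨i, hi, hvi⟩ : ∃ i ≤ m, w i * v i ≠ 0 := by
      by_contra! hcon
      have : w ⬝ᵥ v = 0 := Finset.sum_eq_zero fun i _ => by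
        rcases le_or_gt i m with h | h
        · exact hcon i h
        · rw [hw0 i h, zero_mul]
      omega
    have hwi : w i * v i = 1 := by
      rw [← hwv]
      symm
      refine Finset.sum_eq_single (f := fun j => w j * v j) i (fun j _ hj => ?_)
        fun h => absurd (Finset.mem_univ i) h
      rcases le_or_gt j m with h | h
      · exact mul_eq_zero_of_right _ (hc' i j hi h hj.symm (right_ne_zero_of_mul hvi))
      · exact mul_eq_zero_of_left (hw0 j h) _
    have hu : v i * v i = 1 := by
      rcases Int.eq_one_or_neg_one_of_mul_eq_one
          (by rwa [mul_comm] at hwi : v i * w i = 1) with h | h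
        <;> rw [h] <;> norm_num
    rcases hi.eq_or_lt with rfl | hi
    · rcases Nat.eq_zero_or_pos i.val with h0 | h0
      · refine caseOne g hg ?_
        have htri : g.1.BlockTriangular OrderDual.toDual := by
          intro a b hab
          have hab : a < b := hab
          have hib : i < b := lt_of_le_of_lt (Fin.le_def.2 (by omega)) hab
          have := congrFun (hg b hib) a
          rw [mulVec_single_one] at this
          simpa [hab.ne] using this
        have hdet := det_of_isLowerTriangular _ htri
        rw [g.2, Finset.prod_eq_single i] at hdet
        · simpa using hdet.symm
        · intro b _ hb
          have hib : i < b := lt_of_le_of_ne (Fin.le_def.2 (by omega)) hb.symm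
          have := congrFun (hg b hib) b
          rw [mulVec_single_one] at this
          simpa using this
        · simp
      · have hlt : (⟨0, i.pos⟩ : Fin n) < i := Fin.lt_def.2 h0
        refine cancel _ g (tv_smul_stdv_mem_elemPow_one
          (v i * (1 - v ⟨0, i.pos⟩)) hlt.ne)
          (caseUnit _ (fix g hg _ _ _ hlt.ne le_rfl) ⟨0, i.pos⟩ hlt ?_)
        rw [SLZ.coe_mul, ← mulVec_mulVec, tv_smul_stdv_mulVec _ hlt.ne, ← hv, ← mul_assoc, hu,
          one_mul]
        simp [-zsmul_eq_mul]
    · exact caseUnit g hg i hi hu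

/-- `SL(n,ℤ)` is generated by the elementary matrices. -/
theorem elemPow_one_eq_top : elemPow n 1 = ⊤ := by
  have key : ∀ m : ℕ, ∀ g : SLZ n, (∀ j : Fin n, m ≤ j.val → g.1 *ᵥ stdv j = stdv j) →
      g ∈ elemPow n 1 := by
    intro m
    induction m with
    | zero =>
      intro g hg
      rw [eq_one_of_fix_stdv fun j => hg j (Nat.zero_le _)]
      exact one_mem _
    | succ m ih =>
      intro g hg
      by_cases hm : m < n
      · exact mem_elemPow_one_step (m := ⟨m, hm⟩) (fun g hg => ih g fun j hj => hg j hj) g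
          fun j hj => hg j hj
      · exact ih g fun j hj => absurd (j.isLt) (by omega)
  exact eq_top_iff.2 fun g _ => key n g fun j hj => absurd j.isLt (by omega)

lemma eq_top_of_stdv_mem {H : Subgroup (SLZ n)}
    (h : ∀ a b : Fin n, a ≠ b → tv (stdv a) (stdv b) ∈ H) : H = ⊤ := by
  rw [← top_le_iff, ← elemPow_one_eq_top]
  refine (Subgroup.closure_le _).2 ?_
  rintro _ ⟨a, b, hab, rfl⟩
  rw [one_smul]
  exact h a b hab

end Generation

section Saturation

variable {n : ℕ}

/-- Some nontrivial power of the transvection along `(x, φ)` lies in `Δ`. -/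
def TVIn (Δ : Subgroup (SLZ n)) (x φ : Fin n → ℤ) : Prop :=
  φ ⬝ᵥ x = 0 ∧ ∃ c : ℤ, c ≠ 0 ∧ tv (c • x) φ ∈ Δ

/-- Some nontrivial power of every transvection with covector `φ` lies in `Δ`. -/
def FullCov (Δ : Subgroup (SLZ n)) (φ : Fin n → ℤ) : Prop :=
  ∀ y, φ ⬝ᵥ y = 0 → TVIn Δ y φ

variable {Δ : Subgroup (SLZ n)} {x y φ ψ : Fin n → ℤ}

lemma dotProduct_zsmul_eq_zero (h : φ ⬝ᵥ x = 0) (c : ℤ) : φ ⬝ᵥ (c • x) = 0 := by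
  rw [dotProduct_smul, h, smul_zero]

lemma zsmul_dotProduct_eq_zero (h : φ ⬝ᵥ x = 0) (c : ℤ) : (c • φ) ⬝ᵥ x = 0 := by
  rw [smul_dotProduct, h, smul_zero]

lemma TVIn.mem_mul {c : ℤ} (h : φ ⬝ᵥ x = 0) (hm : tv (c • x) φ ∈ Δ) (a : ℤ) :
    tv ((a * c) • x) φ ∈ Δ := by
  have := zpow_mem hm a
  rwa [tv_zpow (dotProduct_zsmul_eq_zero h c), smul_smul] at this

lemma TVIn.smul_left (h : TVIn Δ x φ) (a : ℤ) : TVIn Δ (a • x) φ := by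
  obtain ⟨h0, c, hc, hm⟩ := h
  refine ⟨dotProduct_zsmul_eq_zero h0 a, c, hc, ?_⟩
  rw [smul_smul, mul_comm]
  exact TVIn.mem_mul h0 hm a

lemma TVIn.of_smul_left {a : ℤ} (ha : a ≠ 0) (h : TVIn Δ (a • x) φ) : TVIn Δ x φ := by
  obtain ⟨h0, c, hc, hm⟩ := h
  rw [dotProduct_smul, smul_eq_mul] at h0
  rw [smul_smul] at hm
  exact ⟨(mul_eq_zero.1 h0).resolve_left ha, c * a, mul_ne_zero hc ha, hm⟩

lemma TVIn.smul_right (h : TVIn Δ x φ) (a : ℤ) : TVIn Δ x (a • φ) := by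
  obtain ⟨h0, c, hc, hm⟩ := h
  refine ⟨zsmul_dotProduct_eq_zero h0 a, c, hc, ?_⟩
  rw [← tv_smul _ _ _ (dotProduct_zsmul_eq_zero h0 c), smul_smul]
  exact TVIn.mem_mul h0 hm a

lemma TVIn.of_smul_right {a : ℤ} (ha : a ≠ 0) (h : TVIn Δ x (a • φ)) : TVIn Δ x φ := by
  obtain ⟨h0, c, hc, hm⟩ := h
  rw [smul_dotProduct, smul_eq_mul] at h0
  have h1 := (mul_eq_zero.1 h0).resolve_left ha
  rw [← tv_smul _ _ _ (dotProduct_zsmul_eq_zero h1 c), smul_smul] at hm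
  exact ⟨h1, a * c, mul_ne_zero ha hc, hm⟩

lemma TVIn.add_left (hx : TVIn Δ x φ) (hy : TVIn Δ y φ) : TVIn Δ (x + y) φ := by
  obtain ⟨h0, c, hc, hm⟩ := hx
  obtain ⟨h0', c', hc', hm'⟩ := hy
  refine ⟨by rw [dotProduct_add, h0, h0', add_zero], c * c', mul_ne_zero hc hc', ?_⟩
  rw [smul_add, ← tv_mul_left (dotProduct_zsmul_eq_zero h0 _) (dotProduct_zsmul_eq_zero h0' _)]
  refine mul_mem ?_ (TVIn.mem_mul h0' hm' c)
  rw [mul_comm]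
  exact TVIn.mem_mul h0 hm c'

lemma TVIn.add_right (hx : TVIn Δ x φ) (hy : TVIn Δ x ψ) : TVIn Δ x (φ + ψ) := by
  obtain ⟨h0, c, hc, hm⟩ := hx
  obtain ⟨h0', c', hc', hm'⟩ := hy
  refine ⟨by rw [add_dotProduct, h0, h0', add_zero], c * c', mul_ne_zero hc hc', ?_⟩
  rw [← tv_mul_right (dotProduct_zsmul_eq_zero h0 _) (dotProduct_zsmul_eq_zero h0' _)]
  refine mul_mem ?_ (TVIn.mem_mul h0' hm' c)
  rw [mul_comm]
  exact TVIn.mem_mul h0 hm c'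

lemma TVIn.conj (h : TVIn Δ x φ) {g : SLZ n} (hg : g ∈ Δ) :
    TVIn Δ (g.1 *ᵥ x) (φ ᵥ* (g⁻¹ : SLZ n).1) := by
  obtain ⟨h0, c, hc, hm⟩ := h
  refine ⟨(vecMul_inv_dotProduct_mulVec g x φ).trans h0, c, hc, ?_⟩
  rw [← mulVec_smul, ← tv_conj g (dotProduct_zsmul_eq_zero h0 c)]
  exact mul_mem (mul_mem hg hm) (inv_mem hg)

lemma TVIn.commutator (h : TVIn Δ x φ) (h' : TVIn Δ y ψ) (hy : φ ⬝ᵥ y = 0) (hx : ψ ⬝ᵥ x ≠ 0) :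
    TVIn Δ y φ := by
  obtain ⟨h0, c, hc, hm⟩ := h
  obtain ⟨h0', c', hc', hm'⟩ := h'
  have := tv_commutator (dotProduct_zsmul_eq_zero h0' c') (dotProduct_zsmul_eq_zero h0 c)
    (dotProduct_zsmul_eq_zero hy c')
  refine ⟨hy, (ψ ⬝ᵥ (c • x)) * c', mul_ne_zero ?_ hc', ?_⟩
  · rw [dotProduct_smul, smul_eq_mul]
    exact mul_ne_zero hc hx
  · rw [mul_smul, ← this]
    exact mul_mem (mul_mem (mul_mem hm' hm) (inv_mem hm')) (inv_mem hm)

lemma FullCov.zero : FullCov Δ 0 := fun y _ =>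
  ⟨zero_dotProduct y, 1, one_ne_zero, by rw [tv_zero_right]; exact one_mem _⟩

lemma FullCov.smul (h : FullCov Δ φ) (a : ℤ) : FullCov Δ (a • φ) := by
  rcases eq_or_ne a 0 with rfl | ha
  · rw [zero_smul]; exact FullCov.zero
  · intro y hy
    rw [smul_dotProduct, smul_eq_mul] at hy
    exact (h y ((mul_eq_zero.1 hy).resolve_left ha)).smul_right a

lemma FullCov.of_smul {a : ℤ} (ha : a ≠ 0) (h : FullCov Δ (a • φ)) : FullCov Δ φ :=
  fun y hy => (h y (zsmul_dotProduct_eq_zero hy a)).of_smul_right ha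

lemma FullCov.vecMul (h : FullCov Δ φ) {g : SLZ n} (hg : g ∈ Δ) : FullCov Δ (φ ᵥ* g.1) := by
  intro y hy
  rw [← dotProduct_mulVec] at hy
  have := (h _ hy).conj (inv_mem hg)
  rwa [mulVec_mulVec, ← SLZ.coe_mul, inv_mul_cancel, SLZ.coe_one, one_mulVec, inv_inv] at this

lemma FullCov.of_ne {θ : Fin n → ℤ} (h : FullCov Δ θ) (hx : TVIn Δ x φ) (hθ : θ ⬝ᵥ x ≠ 0) :
    FullCov Δ φ := by
  intro y hy
  have h1 : θ ⬝ᵥ ((θ ⬝ᵥ x) • y - (θ ⬝ᵥ y) • x) = 0 := by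
    rw [dotProduct_sub, dotProduct_smul, dotProduct_smul, smul_eq_mul, smul_eq_mul, mul_comm,
      sub_self]
  have h2 : φ ⬝ᵥ ((θ ⬝ᵥ x) • y - (θ ⬝ᵥ y) • x) = 0 := by
    rw [dotProduct_sub, dotProduct_zsmul_eq_zero hy, dotProduct_zsmul_eq_zero hx.1, sub_zero]
  have h3 := (hx.commutator (h _ h1) h2 hθ).add_left (hx.smul_left (θ ⬝ᵥ y))
  rw [sub_add_cancel] at h3
  exact h3.of_smul_left hθ

/-- `Δ` contains, for each `r ≥ 1`, an element congruent mod `r` to any given elementary matrix,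
of the form `g e_{ab}^{1 + rt} g⁻¹` with `g` a product of `r`-th powers of elementary matrices. -/
def ApproxElem (Δ : Subgroup (SLZ n)) : Prop :=
  ∀ r : ℕ, 0 < r → ∀ a b : Fin n, a ≠ b → ∃ g ∈ elemPow n r, ∃ t : ℤ,
    g * tv (stdv a) (stdv b) ^ (1 + r * t) * g⁻¹ ∈ Δ

lemma exists_fullCov_ne_zero (hΔ : ApproxElem Δ) (hφ : FullCov Δ φ) (hφ0 : φ ≠ 0) (hx : x ≠ 0) :
    ∃ θ, FullCov Δ θ ∧ θ ⬝ᵥ x ≠ 0 := by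
  by_cases h : φ ⬝ᵥ x = 0
  swap
  · exact ⟨φ, hφ, h⟩
  obtain ⟨a, ha⟩ : ∃ a, φ a ≠ 0 := Function.ne_iff.1 hφ0
  obtain ⟨b, hab, hb⟩ : ∃ b, a ≠ b ∧ x b ≠ 0 := by
    by_contra! hcon
    have hsum : φ ⬝ᵥ x = φ a * x a :=
      Finset.sum_eq_single (f := fun j => φ j * x j) a
        (fun j _ hj => mul_eq_zero_of_right _ (hcon j hj.symm))
        fun h => absurd (Finset.mem_univ a) h
    have hxa : x a = 0 := (mul_eq_zero.1 (hsum.symm.trans h)).resolve_left ha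
    refine hx (funext fun j => ?_)
    by_cases hj : a = j
    · rw [← hj, hxa]; rfl
    · exact hcon j hj
  set r : ℕ := (φ a * x b).natAbs + 1 with hr
  obtain ⟨g, hg, t, hw⟩ := hΔ r (Nat.succ_pos _) a b hab
  refine ⟨_, hφ.vecMul hw, fun h0 => ?_⟩
  rw [tv_zpow (stdv_dot hab), tv_conj g (dotProduct_zsmul_eq_zero (stdv_dot hab) _),
    vecMul_tv ((vecMul_inv_dotProduct_mulVec g _ _).trans
      (dotProduct_zsmul_eq_zero (stdv_dot hab) _)), add_dotProduct, h, zero_add, mulVec_smul,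
    smul_dotProduct, dotProduct_smul, ← dotProduct_mulVec, single_one_dotProduct, smul_eq_mul,
    smul_eq_mul, dotProduct_mulVec, dotProduct_single_one] at h0
  have h1 : (r : ℤ) ∣ (φ ᵥ* g.1) a - φ a := by
    have : (φ ᵥ* g.1) a - φ a = ∑ i, φ i * ((g.1 *ᵥ stdv a) i - stdv a i) := by
      simp only [mul_sub, Finset.sum_sub_distrib]
      congr 1
      · rw [← dotProduct_single_one (φ ᵥ* g.1) a, ← dotProduct_mulVec]; rfl
      · rw [← dotProduct_single_one φ a]; rfl
    rw [this]
    exact Finset.dvd_sum fun i _ => Dvd.dvd.mul_left (dvd_sub_of_mem_elemPow hg _ i) _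
  have h2 : (r : ℤ) ∣ ((g⁻¹ : SLZ n).1 *ᵥ x) b - x b := dvd_sub_of_mem_elemPow (inv_mem hg) x b
  have h3 : (r : ℤ) ∣ φ a * x b := by
    obtain ⟨u, hu⟩ := h1
    obtain ⟨v, hv⟩ := h2
    rw [sub_eq_iff_eq_add] at hu hv
    rw [hu, hv] at h0
    exact ⟨-((u * (r * v + x b) + φ a * v) + t * ((r * u + φ a) * (r * v + x b))), by
      linear_combination h0⟩
  have h4 := Int.natAbs_dvd_natAbs.2 h3
  rw [Int.natAbs_natCast] at h4
  exact absurd (Nat.le_of_dvd (Int.natAbs_pos.2 (mul_ne_zero ha hb)) h4) (by omega)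

lemma exists_common_zero (hn : 3 ≤ n) (φ ψ : Fin n → ℤ) :
    ∃ x : Fin n → ℤ, x ≠ 0 ∧ φ ⬝ᵥ x = 0 ∧ ψ ⬝ᵥ x = 0 := by
  by_contra! hcon
  let f : (Fin n → ℤ) →ₗ[ℤ] (Fin 2 → ℤ) := mulVecLin (Matrix.of ![φ, ψ])
  have hf : Function.Injective f := by
    rw [← LinearMap.ker_eq_bot, LinearMap.ker_eq_bot']
    intro x hx
    by_contra h0
    exact hcon x h0 (congrFun hx 0) (congrFun hx 1)
  have := LinearMap.finrank_le_finrank_of_injective hf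
  simp at this
  omega

lemma FullCov.add (hn : 3 ≤ n) (hΔ : ApproxElem Δ) (hφ : FullCov Δ φ) (hψ : FullCov Δ ψ) :
    FullCov Δ (φ + ψ) := by
  rcases eq_or_ne φ 0 with rfl | h0
  · rwa [zero_add]
  obtain ⟨x, hx, h1, h2⟩ := exists_common_zero hn φ ψ
  obtain ⟨θ, hθ, hθx⟩ := exists_fullCov_ne_zero hΔ hφ h0 hx
  exact hθ.of_ne ((hφ x h1).add_right (hψ x h2)) hθx

lemma exists_int_multiple {ι : Type*} [Finite ι] (v : ι → ℚ) :
    ∃ N : ℤ, N ≠ 0 ∧ ∃ w : ι → ℤ, ∀ i, (w i : ℚ) = N * v i := by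
  have := Fintype.ofFinite ι
  refine ⟨∏ i, ((v i).den : ℤ), Finset.prod_ne_zero_iff.2 fun i _ => by simp, ?_⟩
  have : ∀ i, ∃ m : ℤ, (m : ℚ) = ((∏ j, ((v j).den : ℤ) : ℤ) : ℚ) * v i := by
    intro i
    obtain ⟨m, hm⟩ := Finset.dvd_prod_of_mem (fun j => ((v j).den : ℤ)) (Finset.mem_univ i)
    refine ⟨m * (v i).num, ?_⟩
    rw [hm]
    push_cast
    have := Rat.mul_den_eq_num (v i)
    rw [← this]; ring
  choose w hw using this
  exact ⟨w, hw⟩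

lemma exists_int_annihilator {V : Submodule ℚ (Fin n → ℚ)} (hV : V ≠ ⊤) :
    ∃ w : Fin n → ℤ, w ≠ 0 ∧ ∀ v ∈ V, ∑ i, v i * (w i : ℚ) = 0 := by
  obtain ⟨f, hf0, hf⟩ := Submodule.exists_le_ker_of_lt_top V (lt_top_iff_ne_top.2 hV)
  obtain ⟨N, hN, w, hw⟩ := exists_int_multiple fun i => f (Pi.single i 1)
  have hfv : ∀ v, f v = ∑ i, v i * f (Pi.single i 1) := by
    intro v
    conv_lhs => rw [pi_eq_sum_univ' v]
    rw [map_sum]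
    refine Finset.sum_congr rfl fun i _ => ?_
    rw [map_smul, smul_eq_mul]
  refine ⟨w, ?_, fun v hv => ?_⟩
  · rintro rfl
    refine hf0 (LinearMap.ext fun v => ?_)
    rw [hfv]
    refine Finset.sum_eq_zero fun i _ => ?_
    have := hw i
    simp only [Pi.zero_apply, Int.cast_zero, zero_eq_mul, Int.cast_eq_zero, hN, false_or] at this
    rw [this, mul_zero]
  · have : ∑ i, v i * (w i : ℚ) = N * f v := by
      rw [hfv, Finset.mul_sum]
      refine Finset.sum_congr rfl fun i _ => ?_
      rw [hw]; ring
    rw [this, hf hv, mul_zero]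

lemma fullCov_all (hn : 3 ≤ n) (hΔ : ApproxElem Δ) (hφ : FullCov Δ φ) (hφ0 : φ ≠ 0)
    (χ : Fin n → ℤ) : FullCov Δ χ := by
  let V : Submodule ℚ (Fin n → ℚ) :=
    { carrier := {v | ∃ N : ℤ, N ≠ 0 ∧ ∃ θ, FullCov Δ θ ∧ ∀ i, (θ i : ℚ) = N * v i}
      zero_mem' := ⟨1, one_ne_zero, 0, FullCov.zero, by simp⟩
      add_mem' := by
        rintro v w ⟨N, hN, θ, hθ, hv⟩ ⟨M, hM, χ, hχ, hw⟩
        refine ⟨N * M, mul_ne_zero hN hM, _, (hθ.smul M).add hn hΔ (hχ.smul N), fun i => ?_⟩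
        simp only [Pi.add_apply, Pi.smul_apply, smul_eq_mul]
        push_cast
        rw [hv, hw]; ring
      smul_mem' := by
        rintro q v ⟨N, hN, θ, hθ, hv⟩
        refine ⟨q.den * N, mul_ne_zero (by simp) hN, _, hθ.smul q.num, fun i => ?_⟩
        simp only [Pi.smul_apply, smul_eq_mul]
        push_cast
        rw [hv, ← Rat.mul_den_eq_num q]; ring }
  have hV : V = ⊤ := by
    by_contra hV
    obtain ⟨w, hw0, hw⟩ := exists_int_annihilator hV
    obtain ⟨θ, hθ, hθw⟩ := exists_fullCov_ne_zero hΔ hφ hφ0 hw0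
    have hz := hw (fun i => (θ i : ℚ)) ⟨1, one_ne_zero, θ, hθ, fun i => by simp⟩
    exact hθw (by exact_mod_cast hz)
  obtain ⟨N, hN, θ, hθ, h⟩ : (fun i => (χ i : ℚ)) ∈ V := hV ▸ Submodule.mem_top
  have : θ = N • χ := funext fun i => by
    have : (θ i : ℚ) = N * χ i := h i
    rw [Pi.smul_apply, smul_eq_mul]
    exact_mod_cast this
  exact (this ▸ hθ).of_smul hN

theorem eq_top_of_fullCov (hn : 3 ≤ n) (hΔ : ApproxElem Δ) (hφ : FullCov Δ φ) (hφ0 : φ ≠ 0) :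
    Δ = ⊤ := by
  have h1 : ∀ a b : Fin n, ∃ c : ℤ, c ≠ 0 ∧ (a ≠ b → tv (c • stdv a) (stdv b) ∈ Δ) := by
    intro a b
    by_cases hab : a = b
    · exact ⟨1, one_ne_zero, fun h => absurd hab h⟩
    · obtain ⟨-, c, hc, hm⟩ := fullCov_all hn hΔ hφ hφ0 (stdv b) (stdv a) (stdv_dot hab)
      exact ⟨c, hc, fun _ => hm⟩
  choose c hc hcm using h1
  set N : ℕ := ∏ p : Fin n × Fin n, (c p.1 p.2).natAbs with hN
  have hN0 : 0 < N := Finset.prod_pos fun p _ => Int.natAbs_pos.2 (hc _ _)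
  have hmem : ∀ a b : Fin n, a ≠ b → tv ((N : ℤ) • stdv a) (stdv b) ∈ Δ := by
    intro a b hab
    have h2 : c a b ∣ (N : ℤ) := by
      rw [← Int.natAbs_dvd, Int.natCast_dvd_natCast]
      exact Finset.dvd_prod_of_mem (fun p : Fin n × Fin n => (c p.1 p.2).natAbs)
        (Finset.mem_univ (a, b))
    obtain ⟨m, hm⟩ := h2
    rw [hm, mul_comm]
    exact TVIn.mem_mul (stdv_dot hab) (hcm a b hab) m
  have hle : elemPow n N ≤ Δ := by
    refine (Subgroup.closure_le _).2 ?_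
    rintro _ ⟨a, b, hab, rfl⟩
    exact hmem a b hab
  refine eq_top_of_stdv_mem fun a b hab => ?_
  obtain ⟨g, hg, t, hw⟩ := hΔ N hN0 a b hab
  have h3 : tv (stdv a) (stdv b) ^ (1 + N * t) ∈ Δ := by
    have := mul_mem (mul_mem (inv_mem (hle hg)) hw) (hle hg)
    simpa [mul_assoc] using this
  have h4 : tv (stdv a) (stdv b) ^ (N * t) ∈ Δ := by
    rw [_root_.zpow_mul, tv_zpow (stdv_dot hab)]
    exact zpow_mem (hmem a b hab) t
  rw [_root_.zpow_add, zpow_one] at h3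
  exact (Subgroup.mul_mem_cancel_right _ h4).1 h3

theorem profinitelyDense_of_approxElem {H : Subgroup (SLZ n)} (hH : ApproxElem H) :
    ProfinitelyDense H := by
  intro N hN hfin
  refine eq_top_of_stdv_mem fun a b hab => ?_
  obtain ⟨g, hg, t, hw⟩ := hH N.index (Nat.pos_of_ne_zero hfin.index_ne_zero) a b hab
  have hg' : g ∈ H ⊔ N := le_sup_right (a := H) (elemPow_le_of_normal rfl hg)
  have h3 : tv (stdv a) (stdv b) ^ (1 + N.index * t) ∈ H ⊔ N := by
    have := mul_mem (mul_mem (inv_mem hg') (le_sup_left (b := N) hw)) hg'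
    simpa [mul_assoc] using this
  have h4 : tv (stdv a) (stdv b) ^ (N.index * t) ∈ H ⊔ N := by
    rw [_root_.zpow_mul, zpow_natCast]
    exact zpow_mem (le_sup_right (a := H) (Subgroup.pow_index_mem N _)) t
  rw [_root_.zpow_add, zpow_one] at h3
  exact (Subgroup.mul_mem_cancel_right _ h4).1 h3

end Saturation

section Metric

variable {n : ℕ} {d : Proj n → Proj n → ℝ} {A : Set (Proj n)} {η ρ : ℝ} {x y : Proj n}

lemma IsCompatMetric.nonneg (hd : IsCompatMetric d) (x y : Proj n) : 0 ≤ d x y := by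
  have h1 := hd.triangle x y x
  rw [hd.self, hd.symm y x] at h1
  linarith

lemma IsCompatMetric.bddBelow (hd : IsCompatMetric d) (x : Proj n) (A : Set (Proj n)) :
    BddBelow (d x '' A) := by
  refine ⟨0, ?_⟩
  rintro _ ⟨a, -, rfl⟩
  exact hd.nonneg x a

lemma mem_oThick (hd : IsCompatMetric d) (hA : A.Nonempty) :
    x ∈ oThick d A η ↔ ∃ a ∈ A, d x a < η := by
  rw [oThick, Set.mem_ofPred_eq, setDist, csInf_lt_iff (hd.bddBelow x A) (hA.image _)]
  simp

lemma mem_oThick_singleton (hd : IsCompatMetric d) : x ∈ oThick d {y} η ↔ d x y < η := by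
  rw [mem_oThick hd (Set.singleton_nonempty y)]
  simp

lemma oThick_mono (h : η ≤ ρ) : oThick d A η ⊆ oThick d A ρ :=
  fun _ hx => lt_of_lt_of_le hx h

lemma oThick_subset_cThick (h : η ≤ ρ) : oThick d A η ⊆ cThick d A ρ :=
  fun _ hx => (lt_of_lt_of_le hx h).le

lemma cThick_mono (h : η ≤ ρ) : cThick d A η ⊆ cThick d A ρ :=
  fun _ hx => le_trans hx h

lemma cThick_subset {B : Set (Proj n)} (hd : IsCompatMetric d) (hA : A.Nonempty) (h : A ⊆ B) :
    cThick d A η ⊆ cThick d B η :=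
  fun x hx => le_trans (csInf_le_csInf (hd.bddBelow x B) (hA.image _) (Set.image_mono h)) hx

lemma subset_oThick (hd : IsCompatMetric d) (hη : 0 < η) : A ⊆ oThick d A η := by
  intro x hx
  rw [mem_oThick hd ⟨x, hx⟩]
  exact ⟨x, hx, by rwa [hd.self]⟩

lemma isOpen_oThick (hd : IsCompatMetric d) (hA : A.Nonempty) : IsOpen (oThick d A η) := by
  rw [hd.inducing]
  intro x hx
  obtain ⟨a, ha, hxa⟩ := (mem_oThick hd hA).1 hx
  refine ⟨η - d x a, by linarith, fun y hy => (mem_oThick hd hA).2 ⟨a, ha, ?_⟩⟩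
  have := hd.triangle y x a
  rw [hd.symm y x] at this
  linarith

lemma isClosed_cThick (hd : IsCompatMetric d) (hA : A.Nonempty) : IsClosed (cThick d A η) := by
  rw [← isOpen_compl_iff, hd.inducing]
  intro x hx
  have hx : η < setDist d x A := not_le.1 hx
  refine ⟨setDist d x A - η, by linarith, fun y hy => ?_⟩
  show ¬ setDist d y A ≤ η
  rw [not_le]
  refine lt_of_lt_of_le (by linarith : η < setDist d x A - d x y)
    (le_csInf (hA.image _) ?_)
  rintro _ ⟨a, ha, rfl⟩
  have h1 := hd.triangle x y a
  have h2 : setDist d x A ≤ d x a := csInf_le (hd.bddBelow x A) ⟨a, ha, rfl⟩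
  linarith

lemma oThick_subset_oThick (hd : IsCompatMetric d) {B : Set (Proj n)} (hB : B.Nonempty)
    (hBA : B ⊆ oThick d A ρ) (hA : A.Nonempty) :
    oThick d B η ⊆ oThick d A (ρ + η) := by
  intro x hx
  obtain ⟨b, hb, hxb⟩ := (mem_oThick hd hB).1 hx
  obtain ⟨a, ha, hba⟩ := (mem_oThick hd hA).1 (hBA hb)
  refine (mem_oThick hd hA).2 ⟨a, ha, ?_⟩
  have := hd.triangle x b a
  linarith

lemma exists_oThick_disjoint (hd : IsCompatMetric d) (hA : A.Nonempty) (hAc : IsClosed A)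
    (hx : x ∉ A) :
    ∃ η₀ > 0, ∀ η ≤ η₀, oThick d {x} η ∩ oThick d A η = ∅ := by
  obtain ⟨ε, hε, h⟩ := (hd.inducing _).1 hAc.isOpen_compl x hx
  refine ⟨ε / 2, by linarith, fun η hη => Set.eq_empty_iff_forall_notMem.2 ?_⟩
  rintro y ⟨h1, h2⟩
  rw [mem_oThick_singleton hd] at h1
  obtain ⟨a, ha, hya⟩ := (mem_oThick hd hA).1 h2
  refine h a ?_ ha
  have := hd.triangle x y a
  rw [hd.symm x y] at this
  linarith

end Metric

section Cones

variable {n : ℕ}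

/-- The set of nonzero vectors of `ℝⁿ` representing the points of `U`. -/
def coneOf (U : Set (Proj n)) : Set (Fin n → ℝ) :=
  {w | ∃ h : w ≠ 0, Projectivization.mk ℝ w h ∈ U}

lemma isOpen_coneOf {U : Set (Proj n)} (hU : IsOpen U) : IsOpen (coneOf U) := by
  have h1 : IsOpen {w : {v : Fin n → ℝ // v ≠ 0} | Projectivization.mk ℝ w.1 w.2 ∈ U} :=
    isQuotientMap_quotient_mk'.isOpen_preimage.2 hU
  have h2 : IsOpen {v : Fin n → ℝ | v ≠ 0} := isOpen_ne
  convert h2.isOpenMap_subtype_val _ h1 using 1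
  ext w
  simp [coneOf]

/-- A set of vectors invariant under nonzero scalars. -/
def ScaleInv (C : Set (Fin n → ℝ)) : Prop :=
  ∀ v ∈ C, ∀ c : ℝ, c ≠ 0 → c • v ∈ C

lemma mk_smul {v : Fin n → ℝ} (hv : v ≠ 0) {c : ℝ} (hc : c ≠ 0) :
    Projectivization.mk ℝ (c • v) (smul_ne_zero hc hv) = Projectivization.mk ℝ v hv :=
  (Projectivization.mk_eq_mk_iff' ℝ _ _ _ _).2 ⟨c, rfl⟩

lemma scaleInv_coneOf (U : Set (Proj n)) : ScaleInv (coneOf U) := by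
  rintro v ⟨hv, hU⟩ c hc
  exact ⟨smul_ne_zero hc hv, by rwa [mk_smul hv hc]⟩

/-- The kernel of the functional `v ↦ φ ⬝ v`. -/
def kerOf (φ : Fin n → ℝ) : Submodule ℝ (Fin n → ℝ) where
  carrier := {v | φ ⬝ᵥ v = 0}
  zero_mem' := dotProduct_zero φ
  add_mem' {v w} hv hw := by
    rw [Set.mem_ofPred_eq, dotProduct_add, show φ ⬝ᵥ v = 0 from hv, show φ ⬝ᵥ w = 0 from hw,
      add_zero]
  smul_mem' c v hv := by
    rw [Set.mem_ofPred_eq, dotProduct_smul, show φ ⬝ᵥ v = 0 from hv, smul_zero]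

lemma mem_kerOf {φ v : Fin n → ℝ} : v ∈ kerOf φ ↔ φ ⬝ᵥ v = 0 := Iff.rfl

lemma mk_mem_projSet {W : Submodule ℝ (Fin n → ℝ)} {v : Fin n → ℝ} (hv : v ≠ 0) :
    Projectivization.mk ℝ v hv ∈ projSet W ↔ v ∈ W := by
  rw [projSet, Set.mem_ofPred_eq, Projectivization.submodule_mk,
    Submodule.span_singleton_le_iff_mem]

lemma isClosed_projSet_kerOf (φ : Fin n → ℝ) : IsClosed (projSet (kerOf φ)) := by
  rw [← isOpen_compl_iff]
  refine isQuotientMap_quotient_mk'.isOpen_preimage.1 ?_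
  have : IsOpen {v : {v : Fin n → ℝ // v ≠ 0} | φ ⬝ᵥ v.1 ≠ 0} :=
    isOpen_ne_fun (by fun_prop) continuous_const
  convert this using 1
  ext v
  exact not_congr ((mk_mem_projSet v.2).trans mem_kerOf)

lemma eventually_smul_add_mem {C : Set (Fin n → ℝ)} {v : Fin n → ℝ} (hC : C ∈ nhds v)
    (hs : ScaleInv C) {c : ℝ} (hc : c ≠ 0) (w : Fin n → ℝ) :
    ∀ᶠ j : ℕ in Filter.atTop, (j : ℝ) • (c • v) + w ∈ C := by
  have h1 : Filter.Tendsto (fun j : ℕ => v + ((j : ℝ)⁻¹ * c⁻¹) • w) Filter.atTop (nhds v) := by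
    have h0 : Filter.Tendsto (fun j : ℕ => ((j : ℝ)⁻¹ * c⁻¹)) Filter.atTop (nhds 0) := by
      simpa using tendsto_inv_atTop_nhds_zero_nat.mul_const c⁻¹
    simpa using (h0.smul_const w).const_add v
  filter_upwards [h1.eventually hC, Filter.eventually_gt_atTop 0] with j hj hj0
  have hj1 : (j : ℝ) ≠ 0 := by positivity
  have := hs _ hj (j * c) (mul_ne_zero hj1 hc)
  rwa [smul_add, smul_smul, show (j : ℝ) * c * ((j : ℝ)⁻¹ * c⁻¹) = 1 by field_simp, one_smul,
    mul_smul] at this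

/-- The covectors whose kernel is projectively contained in `U`. -/
def covecsIn (U : Set (Proj n)) : Set (Fin n → ℝ) :=
  {φ | projSet (kerOf φ) ⊆ U}

lemma scaleInv_covecsIn (U : Set (Proj n)) : ScaleInv (covecsIn U) := by
  intro φ hφ c hc
  have : kerOf (c • φ) = kerOf φ := by
    ext v
    rw [mem_kerOf, mem_kerOf, smul_dotProduct, smul_eq_mul, mul_eq_zero, or_iff_right hc]
  rw [covecsIn, Set.mem_ofPred_eq, this]
  exact hφ

lemma mem_coneOf_iff {U : Set (Proj n)} {v : Fin n → ℝ} (hv : v ≠ 0) :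
    v ∈ coneOf U ↔ Projectivization.mk ℝ v hv ∈ U :=
  ⟨fun h => h.2, fun h => ⟨hv, h⟩⟩

lemma exists_norm_one (x : Proj n) :
    ∃ (v : Fin n → ℝ) (hv : v ≠ 0), v ∈ Metric.sphere (0 : Fin n → ℝ) 1 ∧
      Projectivization.mk ℝ v hv = x := by
  induction x using Projectivization.ind with
  | h w hw =>
    have h0 : ‖w‖ ≠ 0 := norm_ne_zero_iff.2 hw
    refine ⟨‖w‖⁻¹ • w, smul_ne_zero (inv_ne_zero h0) hw, ?_, mk_smul hw (inv_ne_zero h0)⟩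
    rw [mem_sphere_zero_iff_norm, norm_smul, norm_inv, norm_norm, inv_mul_cancel₀ h0]

lemma covecsIn_mem_nhds {U : Set (Proj n)} (hU : IsOpen U) {φ : Fin n → ℝ}
    (hφ : projSet (kerOf φ) ⊆ U) : covecsIn U ∈ nhds φ := by
  have h1 : ∀ᶠ ψ in nhds φ, ∀ v ∈ Metric.sphere (0 : Fin n → ℝ) 1, ψ ⬝ᵥ v = 0 → v ∈ coneOf U := by
    refine (isCompact_sphere _ _).eventually_forall_of_forall_eventually fun v hv => ?_
    have hv0 : v ≠ 0 := ne_zero_of_mem_unit_sphere ⟨v, hv⟩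
    by_cases h : φ ⬝ᵥ v = 0
    · have : v ∈ coneOf U := ⟨hv0, hφ ((mk_mem_projSet hv0).2 h)⟩
      filter_upwards [continuous_snd.continuousAt.eventually ((isOpen_coneOf hU).mem_nhds this)]
        with z hz _ using hz
    · have hc : Continuous fun z : (Fin n → ℝ) × (Fin n → ℝ) => z.1 ⬝ᵥ z.2 :=
        continuous_fst.dotProduct continuous_snd
      filter_upwards [hc.continuousAt.eventually (isOpen_ne.mem_nhds h)] with z hz h0
      exact absurd h0 hz
  filter_upwards [h1] with ψ hψ x hx
  obtain ⟨v, hv, hv1, rfl⟩ := exists_norm_one x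
  exact (mem_coneOf_iff hv).1 (hψ v hv1 ((mk_mem_projSet hv).1 hx))

end Cones

section Dynamics

variable {n : ℕ}

/-- The real vector attached to an integral vector. -/
def toR (x : Fin n → ℤ) : Fin n → ℝ := fun i => (x i : ℝ)

lemma toR_ne_zero {x : Fin n → ℤ} (hx : x ≠ 0) : toR x ≠ 0 := by
  contrapose! hx
  funext i
  have : (x i : ℝ) = 0 := congrFun hx i
  exact_mod_cast this

lemma toR_add (x y : Fin n → ℤ) : toR (x + y) = toR x + toR y := by
  ext i; simp [toR]

lemma toR_smul (c : ℤ) (x : Fin n → ℤ) : toR (c • x) = (c : ℝ) • toR x := by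
  ext i; simp [toR]

lemma toR_dotProduct (φ x : Fin n → ℤ) : toR φ ⬝ᵥ toR x = ((φ ⬝ᵥ x : ℤ) : ℝ) := by
  simp [toR, dotProduct]

lemma toR_dotProduct_eq_zero {φ x : Fin n → ℤ} : toR φ ⬝ᵥ toR x = 0 ↔ φ ⬝ᵥ x = 0 := by
  rw [toR_dotProduct, Int.cast_eq_zero]

lemma matR_eq (g : SLZ n) : matR g = g.1.map (Int.cast : ℤ → ℝ) := rfl

lemma matQ_eq (g : SLZ n) : matQ g = g.1.map (Int.cast : ℤ → ℚ) := rfl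

lemma matR_mulVec (g : SLZ n) (x : Fin n → ℤ) : matR g *ᵥ toR x = toR (g.1 *ᵥ x) := by
  ext i; simp [matR_eq, toR, mulVec, dotProduct]

lemma vecMul_matR (g : SLZ n) (x : Fin n → ℤ) : toR x ᵥ* matR g = toR (x ᵥ* g.1) := by
  ext i; simp [matR_eq, toR, vecMul, dotProduct]

lemma matR_mul (g h : SLZ n) : matR (g * h) = matR g * matR h := by
  rw [matR, map_mul]; rfl

lemma matR_one : matR (1 : SLZ n) = 1 := by
  rw [matR, map_one]; rfl

lemma matR_mul_inv (g : SLZ n) : matR g * matR g⁻¹ = 1 := by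
  rw [← matR_mul, mul_inv_cancel, matR_one]

lemma matR_inv_mul (g : SLZ n) : matR g⁻¹ * matR g = 1 := by
  rw [← matR_mul, inv_mul_cancel, matR_one]

lemma matR_mulVec_ne_zero (g : SLZ n) {v : Fin n → ℝ} (hv : v ≠ 0) : matR g *ᵥ v ≠ 0 := by
  intro h
  have := congrArg (matR g⁻¹ *ᵥ ·) h
  simp only [mulVec_mulVec, matR_inv_mul, one_mulVec, mulVec_zero] at this
  exact hv this

lemma act_mk (g : SLZ n) {v : Fin n → ℝ} (hv : v ≠ 0) :
    act g (Projectivization.mk ℝ v hv) =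
      Projectivization.mk ℝ (matR g *ᵥ v) (matR_mulVec_ne_zero g hv) := by
  rw [act, actR, Projectivization.map_mk]
  rfl

lemma actSub_kerOf (g : SLZ n) (φ : Fin n → ℤ) :
    actSub g (kerOf (toR φ)) = kerOf (toR (φ ᵥ* (g⁻¹ : SLZ n).1)) := by
  ext v
  rw [mem_kerOf, ← vecMul_matR, ← dotProduct_mulVec, actSub, Submodule.mem_map]
  constructor
  · rintro ⟨w, hw, rfl⟩
    rw [mulVecLin_apply, mulVec_mulVec, matR_inv_mul, one_mulVec]
    exact hw
  · intro h
    exact ⟨_, h, by rw [mulVecLin_apply, mulVec_mulVec, matR_mul_inv, one_mulVec]⟩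

lemma matR_tv_sub_one {x φ : Fin n → ℤ} (h : φ ⬝ᵥ x = 0) :
    matR (tv x φ) - 1 = vecMulVec (toR x) (toR φ) := by
  rw [matR_eq, tv_coe h]
  ext i j
  by_cases hij : i = j <;> simp [toR, vecMulVec_apply, one_apply, hij]

lemma matQ_tv_sub_one {x φ : Fin n → ℤ} (h : φ ⬝ᵥ x = 0) :
    matQ (tv x φ) - 1 = vecMulVec (fun i => (x i : ℚ)) (fun i => (φ i : ℚ)) := by
  rw [matQ_eq, tv_coe h]
  ext i j
  by_cases hij : i = j <;> simp [vecMulVec_apply, one_apply, hij]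

lemma vecMulVec_mulVec_eq_smul {K : Type*} [CommSemiring K] (x φ v : Fin n → K) :
    vecMulVec x φ *ᵥ v = (φ ⬝ᵥ v) • x := by
  rw [vecMulVec_mulVec]
  ext i; simp [mul_comm]

lemma range_vecMulVec {K : Type*} [Field K] {x φ : Fin n → K} (hφ : φ ≠ 0) :
    LinearMap.range (mulVecLin (vecMulVec x φ)) = Submodule.span K {x} := by
  ext v
  rw [LinearMap.mem_range, Submodule.mem_span_singleton]
  constructor
  · rintro ⟨w, rfl⟩
    exact ⟨φ ⬝ᵥ w, by rw [mulVecLin_apply, vecMulVec_mulVec_eq_smul]⟩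
  · rintro ⟨a, rfl⟩
    obtain ⟨i, hi⟩ : ∃ i, φ i ≠ 0 := Function.ne_iff.1 hφ
    refine ⟨Pi.single i (a / φ i), ?_⟩
    rw [mulVecLin_apply, vecMulVec_mulVec_eq_smul, dotProduct_single, mul_div_cancel₀ _ hi]

lemma isR1U_tv {x φ : Fin n → ℤ} (h : φ ⬝ᵥ x = 0) (hx : x ≠ 0) (hφ : φ ≠ 0) :
    IsR1U (tv x φ) := by
  have cast_ne : ∀ y : Fin n → ℤ, y ≠ 0 → (fun i => (y i : ℚ)) ≠ 0 := by
    intro y hy h0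
    refine hy (funext fun i => ?_)
    have : (y i : ℚ) = 0 := congrFun h0 i
    exact_mod_cast this
  refine ⟨⟨2, ?_⟩, ?_⟩
  · rw [linQ, matQ_tv_sub_one h, pow_two]
    refine LinearMap.ext fun v => ?_
    have h0 : (fun i => (φ i : ℚ)) ⬝ᵥ (fun i => (x i : ℚ)) = 0 := by
      have : ((φ ⬝ᵥ x : ℤ) : ℚ) = 0 := by rw [h, Int.cast_zero]
      simpa [dotProduct] using this
    rw [Module.End.mul_apply, mulVecLin_apply, mulVecLin_apply, vecMulVec_mulVec_eq_smul,
      vecMulVec_mulVec_eq_smul, dotProduct_smul, h0, smul_zero, zero_smul, LinearMap.zero_apply]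
  · rw [linQ, matQ_tv_sub_one h, range_vecMulVec (cast_ne φ hφ)]
    exact finrank_span_singleton (cast_ne x hx)

lemma attSet_tv {x φ : Fin n → ℤ} (h : φ ⬝ᵥ x = 0) (hx : x ≠ 0) (hφ : φ ≠ 0) :
    attSet (tv x φ) = {Projectivization.mk ℝ (toR x) (toR_ne_zero hx)} := by
  ext y
  rw [attSet, Set.mem_ofPred_eq, Set.mem_singleton_iff, lineOf, matR_tv_sub_one h,
    range_vecMulVec (toR_ne_zero hφ), ← Projectivization.submodule_mk _ (toR_ne_zero hx),
    Projectivization.submodule_injective.eq_iff]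

lemma fixSet_tv {x φ : Fin n → ℤ} (h : φ ⬝ᵥ x = 0) (hx : x ≠ 0) :
    fixSet (tv x φ) = projSet (kerOf (toR φ)) := by
  have : hypOf (tv x φ) = kerOf (toR φ) := by
    ext v
    rw [hypOf, LinearMap.mem_ker, matR_tv_sub_one h, mulVecLin_apply, vecMulVec_mulVec_eq_smul,
      smul_eq_zero, or_iff_left (toR_ne_zero hx), mem_kerOf]
  rw [fixSet, this, projSet]

lemma mk_toR_smul {x : Fin n → ℤ} (hx : x ≠ 0) {m : ℤ} (hm : m ≠ 0) :
    Projectivization.mk ℝ (toR (m • x)) (toR_ne_zero (smul_ne_zero hm hx)) =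
      Projectivization.mk ℝ (toR x) (toR_ne_zero hx) := by
  refine (Projectivization.mk_eq_mk_iff' ℝ _ _ _ _).2 ⟨m, (toR_smul m x).symm⟩

/-- Ping-pong dynamics of all nontrivial powers of `u`. -/
def Contracts (d : Proj n → Proj n → ℝ) (u : SLZ n) (η₁ η₂ : ℝ) : Prop :=
  ∀ k : ℤ, k ≠ 0 → ∀ x, x ∉ oThick d (fixSet u) η₂ → act (u ^ k) x ∈ oThick d (attSet u) η₁

/-- Large powers of a transvection contract the complement of a neighbourhood of the fixed
hyperplane into a neighbourhood of the attracting point. -/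
lemma exists_contracts_tv {d : Proj n → Proj n → ℝ} (hd : IsCompatMetric d) {x φ : Fin n → ℤ}
    (h : φ ⬝ᵥ x = 0) (hx : x ≠ 0) (hφ : φ ≠ 0) {η₁ η₂ : ℝ} (h₁ : 0 < η₁) (h₂ : 0 < η₂) :
    ∃ M : ℕ, 0 < M ∧ ∀ m : ℤ, (M : ℤ) ≤ |m| → Contracts d (tv (m • x) φ) η₁ η₂ := by
  have hP : (projSet (kerOf (toR φ))).Nonempty :=
    ⟨_, (mk_mem_projSet (toR_ne_zero hx)).2 (mem_kerOf.2 (toR_dotProduct_eq_zero.2 h))⟩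
  set P := projSet (kerOf (toR φ)) with hPdef
  set q := Projectivization.mk ℝ (toR x) (toR_ne_zero hx) with hq
  have hU := isOpen_coneOf (isOpen_oThick (η := η₂) hd hP)
  have hV := isOpen_coneOf (isOpen_oThick (η := η₁) hd (Set.singleton_nonempty q))
  set U := coneOf (oThick d P η₂)
  set V := coneOf (oThick d {q} η₁)
  have hxV : toR x ∈ V := ⟨toR_ne_zero hx, subset_oThick hd h₁ rfl⟩
  have hev : ∀ᶠ s in nhds (0 : ℝ), ∀ v ∈ Metric.sphere (0 : Fin n → ℝ) 1 \ U,
      s • v + (toR φ ⬝ᵥ v) • toR x ∈ V := by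
    refine ((isCompact_sphere _ _).diff hU).eventually_forall_of_forall_eventually fun v hv => ?_
    have hv0 : v ≠ 0 := ne_zero_of_mem_unit_sphere ⟨v, hv.1⟩
    have h0 : toR φ ⬝ᵥ v ≠ 0 := fun h0 =>
      hv.2 ⟨hv0, subset_oThick hd h₂ ((mk_mem_projSet hv0).2 h0)⟩
    have hc : Continuous fun z : ℝ × (Fin n → ℝ) => z.1 • z.2 + (toR φ ⬝ᵥ z.2) • toR x := by
      fun_prop
    refine hc.continuousAt.eventually (hV.mem_nhds ?_)
    simpa using scaleInv_coneOf _ _ hxV _ h0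
  obtain ⟨ε, hε, hball⟩ := Metric.eventually_nhds_iff.1 hev
  obtain ⟨M, hM⟩ := exists_nat_gt ε⁻¹
  have hM0 : 0 < M := by
    have := (inv_pos.2 hε).trans hM
    exact_mod_cast this
  refine ⟨M, hM0, fun m hm k hk y hy => ?_⟩
  have hm0 : m ≠ 0 := by rintro rfl; simp at hm; omega
  have hmx := dotProduct_zsmul_eq_zero h m
  rw [fixSet_tv hmx (smul_ne_zero hm0 hx)] at hy
  rw [attSet_tv hmx (smul_ne_zero hm0 hx) hφ, mk_toR_smul hx hm0, tv_zpow hmx, smul_smul]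
  obtain ⟨v, hv, hv1, rfl⟩ := exists_norm_one y
  rw [act_mk]
  have hkm : ((k * m : ℤ) : ℝ) ≠ 0 := by exact_mod_cast mul_ne_zero hk hm0
  have hlt : dist (((k * m : ℤ) : ℝ)⁻¹) 0 < ε := by
    rw [dist_zero_right, norm_inv, inv_lt_comm₀ (norm_pos_iff.2 hkm) hε]
    refine hM.trans_le ?_
    rw [Int.norm_cast_real, Int.norm_eq_abs, Int.cast_mul, abs_mul]
    have h1 : (1 : ℝ) ≤ |(k : ℝ)| := by exact_mod_cast Int.one_le_abs hk
    have h2 : (M : ℝ) ≤ |(m : ℝ)| := by exact_mod_cast hm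
    nlinarith [abs_nonneg (m : ℝ)]
  have hmem := hball hlt v ⟨hv1, fun hvU => hy ((mem_coneOf_iff hv).1 hvU)⟩
  have hmem2 := scaleInv_coneOf _ _ hmem _ hkm
  have heq : ((k * m : ℤ) : ℝ) • ((((k * m : ℤ) : ℝ)⁻¹) • v + (toR φ ⬝ᵥ v) • toR x) =
      matR (tv ((k * m) • x) φ) *ᵥ v := by
    have h3 : matR (tv ((k * m) • x) φ) = 1 + vecMulVec (toR ((k * m) • x)) (toR φ) := by
      rw [← matR_tv_sub_one (dotProduct_zsmul_eq_zero h _)]; abel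
    rw [h3, add_mulVec, one_mulVec, vecMulVec_mulVec_eq_smul, smul_add, smul_smul,
      mul_inv_cancel₀ hkm, one_smul, toR_smul, smul_comm]
  rw [heq] at hmem2
  exact (mem_coneOf_iff _).1 hmem2

end Dynamics

section RationalData

variable {n : ℕ}

lemma RatPoint.exists_int {p : Proj n} (hp : RatPoint p) :
    ∃ (x : Fin n → ℤ) (hx : x ≠ 0), p = Projectivization.mk ℝ (toR x) (toR_ne_zero hx) := by
  obtain ⟨v, hv⟩ := hp
  obtain ⟨N, hN, x, hx⟩ := exists_int_multiple v
  have hNr : (N : ℝ) ≠ 0 := by exact_mod_cast hN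
  have hxv : toR x = (N : ℝ) • fun i => ((v i : ℝ)) := by
    ext i
    have := congrArg (fun q : ℚ => (q : ℝ)) (hx i)
    push_cast at this
    simpa [toR] using this
  have hspan : p.submodule = Submodule.span ℝ {toR x} := by
    rw [hv, hxv, Submodule.span_singleton_smul_eq (IsUnit.mk0 _ hNr)]
  have hx0 : x ≠ 0 := by
    rintro rfl
    have h0 : toR (0 : Fin n → ℤ) = 0 := by ext i; simp [toR]
    rw [h0, Submodule.span_zero_singleton] at hspan
    have := Projectivization.finrank_submodule p
    rw [hspan, finrank_bot] at this
    omega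
  refine ⟨x, hx0, Projectivization.submodule_injective ?_⟩
  rw [hspan, Projectivization.submodule_mk]

lemma kerOf_ne_top {φ : Fin n → ℝ} (hφ : φ ≠ 0) : kerOf φ ≠ ⊤ := by
  intro h
  refine hφ (dotProduct_self_eq_zero.1 (mem_kerOf.1 (h ▸ Submodule.mem_top)))

lemma IsRatSubmodule.exists_int {W : Submodule ℝ (Fin n → ℝ)} (hW : IsRatSubmodule W)
    (hn : 0 < n) (hr : Module.finrank ℝ W = n - 1) :
    ∃ φ : Fin n → ℤ, φ ≠ 0 ∧ W = kerOf (toR φ) := by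
  obtain ⟨T, hT⟩ := hW
  have hV : Submodule.span ℚ T ≠ ⊤ := by
    intro hV
    let f : (Fin n → ℚ) →ₗ[ℚ] (Fin n → ℝ) :=
      { toFun := fun v i => (v i : ℝ)
        map_add' := fun v w => by ext i; simp
        map_smul' := fun c v => by ext i; simp [Rat.smul_def] }
    have h1 : (Submodule.span ℚ T).map f ≤ W.restrictScalars ℚ := by
      rw [Submodule.map_span, Submodule.span_le, hT]
      exact Submodule.subset_span
    have h2 : W = ⊤ := by
      rw [eq_top_iff, ← (Pi.basisFun ℝ (Fin n)).span_eq, Submodule.span_le]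
      rintro _ ⟨i, rfl⟩
      have : f (Pi.single i 1) ∈ W := h1 ⟨_, hV ▸ Submodule.mem_top, rfl⟩
      have e : Pi.basisFun ℝ (Fin n) i = f (Pi.single i 1) := by
        ext j
        by_cases hij : j = i
        · subst hij; simp [f]
        · simp [f, hij]
      rw [SetLike.mem_coe, e]
      exact this
    rw [h2, finrank_top, Module.finrank_fin_fun] at hr
    omega
  obtain ⟨w, hw0, hw⟩ := exists_int_annihilator hV
  refine ⟨w, hw0, ?_⟩
  have hle : W ≤ kerOf (toR w) := by
    rw [hT, Submodule.span_le]
    rintro _ ⟨v, hv, rfl⟩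
    have := congrArg (fun q : ℚ => (q : ℝ)) (hw v (Submodule.subset_span hv))
    push_cast at this
    rw [SetLike.mem_coe, mem_kerOf, dotProduct_comm]
    exact this
  refine Submodule.eq_of_le_of_finrank_le hle ?_
  have h3 := Submodule.finrank_lt (kerOf_ne_top (toR_ne_zero hw0))
  rw [Module.finrank_fin_fun] at h3
  omega

/-- If two integral covectors have different kernels, then some integral vector is killed by the
first one and not by the second one. -/
lemma exists_dotProduct_ne_zero {φ ψ : Fin n → ℤ} (hφ : φ ≠ 0) (hψ : ψ ≠ 0)
    (h : kerOf (toR ψ) ≠ kerOf (toR φ)) : ∃ z, φ ⬝ᵥ z = 0 ∧ ψ ⬝ᵥ z ≠ 0 := by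
  by_contra! hcon
  obtain ⟨i, hi⟩ : ∃ i, φ i ≠ 0 := Function.ne_iff.1 hφ
  have h1 : φ i • ψ = ψ i • φ := by
    ext j
    have := hcon (φ i • stdv j - φ j • stdv i)
      (by simp [-zsmul_eq_mul, dotProduct_sub, mul_comm])
    rw [dotProduct_sub, dotProduct_smul, dotProduct_smul, dotProduct_single_one,
      dotProduct_single_one, smul_eq_mul, smul_eq_mul, sub_eq_zero] at this
    rw [Pi.smul_apply, Pi.smul_apply, smul_eq_mul, smul_eq_mul, this, mul_comm]
  have h2 : ψ i ≠ 0 := by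
    intro h0
    rw [h0, zero_smul] at h1
    exact (smul_ne_zero hi hψ) h1
  apply h
  ext v
  have h3 := congrArg (fun χ => toR χ ⬝ᵥ v) h1
  simp only [toR_smul, smul_dotProduct, smul_eq_mul] at h3
  have hi' : (φ i : ℝ) ≠ 0 := by exact_mod_cast hi
  have h2' : (ψ i : ℝ) ≠ 0 := by exact_mod_cast h2
  rw [mem_kerOf, mem_kerOf]
  constructor
  · intro h4
    rw [h4, mul_zero] at h3
    exact (mul_eq_zero.1 h3.symm).resolve_left h2'
  · intro h4
    rw [h4, mul_zero] at h3
    exact (mul_eq_zero.1 h3).resolve_left hi'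

end RationalData

section Approximation

variable {n : ℕ}

/-- An integral flag `X ∈ ker Φ` in general position with respect to the flag `p ∈ ker ψ`, with `X`
and `Φ` in prescribed sets. -/
structure NearFlag (p ψ : Fin n → ℤ) (C D : Set (Fin n → ℝ)) (X Φ : Fin n → ℤ) : Prop where
  flag : Φ ⬝ᵥ X = 0
  memC : toR X ∈ C
  memD : toR Φ ∈ D
  left : ψ ⬝ᵥ X ≠ 0
  right : Φ ⬝ᵥ p ≠ 0

variable {p ψ : Fin n → ℤ} {C D : Set (Fin n → ℝ)}

lemma eventually_toR_mem {v : Fin n → ℤ} (hC : C ∈ nhds (toR v)) (hs : ScaleInv C) {c : ℤ}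
    (hc : c ≠ 0) (w : Fin n → ℤ) :
    ∀ᶠ j : ℕ in Filter.atTop, toR (((j : ℤ) * c) • v + w) ∈ C := by
  have hc' : (c : ℝ) ≠ 0 := by exact_mod_cast hc
  filter_upwards [eventually_smul_add_mem hC hs hc' (toR w)] with j hj
  rwa [toR_add, toR_smul, Int.cast_mul, mul_smul, Int.cast_natCast]

lemma eventually_mul_add_ne_zero {α β : ℤ} (h : α ≠ 0 ∨ β ≠ 0) :
    ∀ᶠ j : ℕ in Filter.atTop, (j : ℤ) * α + β ≠ 0 := by
  rcases eq_or_ne α 0 with rfl | hα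
  · exact Filter.Eventually.of_forall fun j => by simpa using h
  · filter_upwards [Filter.eventually_gt_atTop β.natAbs] with j hj h0
    have h1 : β.natAbs = j * α.natAbs := by
      rw [show β = -((j : ℤ) * α) by linarith, Int.natAbs_neg, Int.natAbs_mul, Int.natAbs_natCast]
    have h2 := Nat.le_mul_of_pos_right j (Int.natAbs_pos.2 hα)
    omega

lemma exists_dotProduct_ne_zero_and_apply_ne_zero {x : Fin n → ℤ} (hx : x ≠ 0) (a : Fin n) :
    ∃ μ : Fin n → ℤ, μ ⬝ᵥ x ≠ 0 ∧ μ a ≠ 0 := by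
  by_cases ha : x a = 0
  · obtain ⟨i, hi⟩ : ∃ i, x i ≠ 0 := Function.ne_iff.1 hx
    have hia : a ≠ i := by rintro rfl; exact hi ha
    refine ⟨stdv a + stdv i, ?_, ?_⟩
    · rwa [add_dotProduct, single_one_dotProduct, single_one_dotProduct, ha, zero_add]
    · rw [Pi.add_apply, stdv_apply_self, stdv_apply_ne hia]; norm_num
  · exact ⟨stdv a, by rwa [single_one_dotProduct], by rw [stdv_apply_self]; norm_num⟩

/-- The flags `(j p + z, j μ(p) ψ + μ(z) ψ - ψ(z) μ)` converge to `(p, ψ)`. -/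
lemma eventually_nearFlag (hpψ : ψ ⬝ᵥ p = 0) (hC : C ∈ nhds (toR p)) (hCs : ScaleInv C)
    (hD : D ∈ nhds (toR ψ)) (hDs : ScaleInv D) {z μ : Fin n → ℤ} (hz : ψ ⬝ᵥ z ≠ 0)
    (hμ : μ ⬝ᵥ p ≠ 0) :
    ∀ᶠ j : ℕ in Filter.atTop, NearFlag p ψ C D ((j : ℤ) • p + z)
      (((j : ℤ) * (μ ⬝ᵥ p)) • ψ + ((μ ⬝ᵥ z) • ψ - (ψ ⬝ᵥ z) • μ)) := by
  have h1 := eventually_toR_mem hC hCs one_ne_zero z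
  simp only [mul_one] at h1
  filter_upwards [h1, eventually_toR_mem hD hDs hμ ((μ ⬝ᵥ z) • ψ - (ψ ⬝ᵥ z) • μ)] with j hj hj'
  refine ⟨?_, hj, hj', ?_, ?_⟩
  · simp only [add_dotProduct, dotProduct_add, sub_dotProduct, smul_dotProduct, dotProduct_smul,
      smul_eq_mul, hpψ]
    ring
  · rwa [dotProduct_add, dotProduct_smul, hpψ, smul_zero, zero_add]
  · rw [add_dotProduct, sub_dotProduct, smul_dotProduct, smul_dotProduct, smul_dotProduct, hpψ,
      smul_zero, smul_zero, zero_add, zero_sub, neg_ne_zero, smul_eq_mul]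
    exact mul_ne_zero hz hμ

/-- Conjugates of elementary matrices by elements of `elemPow n r` whose flag is close to
`(p, ψ)`. -/
lemma exists_conj_nearFlag (hn : 3 ≤ n) (hp : p ≠ 0) (hψ : ψ ≠ 0) (hpψ : ψ ⬝ᵥ p = 0)
    (hC : IsOpen C) (hpC : toR p ∈ C) (hCs : ScaleInv C) (hD : D ∈ nhds (toR ψ))
    (hDs : ScaleInv D) (hDo : ∀ φ ∈ D, φ ≠ 0 → D ∈ nhds φ) {r : ℕ} (hr : 0 < r) {a b : Fin n}
    (hab : a ≠ b) :
    ∃ g ∈ elemPow n r, NearFlag p ψ C D (g.1 *ᵥ stdv a) (stdv b ᵥ* (g⁻¹ : SLZ n).1) := by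
  obtain ⟨μ, hμ, hμa⟩ := exists_dotProduct_ne_zero_and_apply_ne_zero hp a
  obtain ⟨z, hz, hzb⟩ := exists_dotProduct_ne_zero_and_apply_ne_zero hψ b
  rw [dotProduct_comm] at hz
  have e1 : ∀ᶠ j : ℕ in Filter.atTop, ((j : ℤ) • p + z) b ≠ 0 :=
    eventually_mul_add_ne_zero (Or.inr hzb)
  have e2 : ∀ᶠ j : ℕ in Filter.atTop,
      (((j : ℤ) * (μ ⬝ᵥ p)) • ψ + ((μ ⬝ᵥ z) • ψ - (ψ ⬝ᵥ z) • μ)) a ≠ 0 := by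
    have : (μ ⬝ᵥ p) * ψ a ≠ 0 ∨ (μ ⬝ᵥ z) * ψ a - (ψ ⬝ᵥ z) * μ a ≠ 0 := by
      rcases eq_or_ne (ψ a) 0 with h0 | h0
      · right
        rw [h0, mul_zero, zero_sub, neg_ne_zero]
        exact mul_ne_zero hz hμa
      · exact Or.inl (mul_ne_zero hμ h0)
    filter_upwards [eventually_mul_add_ne_zero this] with j hj
    rwa [← mul_assoc] at hj
  obtain ⟨j, ⟨hflag, hXC, hXD, hl, hr'⟩, hXb, hΦa⟩ :=
    ((eventually_nearFlag hpψ (hC.mem_nhds hpC) hCs hD hDs hz hμ).and (e1.and e2)).exists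
  generalize hX : (j : ℤ) • p + z = X at *
  generalize hΦ : ((j : ℤ) * (μ ⬝ᵥ p)) • ψ + ((μ ⬝ᵥ z) • ψ - (ψ ⬝ᵥ z) • μ) = Φ at *
  have hΦ0 : Φ ≠ 0 := by rintro rfl; exact hΦa rfl
  have hr0 : (r : ℤ) ^ 2 ≠ 0 := pow_ne_zero 2 (by exact_mod_cast hr.ne')
  set α : ℤ := r ^ 2 * (X b * Φ a) with hα
  set β : ℤ := -(r ^ 2 * X b * X b) with hβ
  have hα0 : α ≠ 0 := mul_ne_zero hr0 (mul_ne_zero hXb hΦa)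
  have hβ0 : β ≠ 0 := neg_ne_zero.2 (mul_ne_zero (mul_ne_zero hr0 hXb) hXb)
  obtain ⟨t, ht1, ht2, ht3, ht4⟩ :=
    ((eventually_toR_mem (hC.mem_nhds hXC) hCs hα0 (stdv a)).and
      ((eventually_toR_mem (hDo _ hXD (toR_ne_zero hΦ0)) hDs hβ0 (stdv b)).and
      ((eventually_mul_add_ne_zero (α := α * (ψ ⬝ᵥ X)) (β := ψ a)
        (Or.inl (mul_ne_zero hα0 hl))).and
      (eventually_mul_add_ne_zero (α := β * (Φ ⬝ᵥ p)) (β := p b)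
        (Or.inl (mul_ne_zero hβ0 hr')))))).exists
  have hflag' : (X b • Φ) ⬝ᵥ (((r : ℤ) ^ 2 * t) • X) = 0 := by
    rw [smul_dotProduct, dotProduct_smul, hflag, smul_zero, smul_zero]
  have hga : (tv (((r : ℤ) ^ 2 * t) • X) (X b • Φ)).1 *ᵥ stdv a = ((t : ℤ) * α) • X + stdv a := by
    rw [tv_mulVec hflag', dotProduct_single_one, Pi.smul_apply, smul_smul, add_comm, hα,
      smul_eq_mul]
    congr 2; ring
  have hgb : stdv b ᵥ* ((tv (((r : ℤ) ^ 2 * t) • X) (X b • Φ))⁻¹ : SLZ n).1 =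
      ((t : ℤ) * β) • Φ + stdv b := by
    rw [tv_inv hflag', vecMul_tv (by rw [dotProduct_neg, hflag', neg_zero]), single_one_dotProduct,
      Pi.neg_apply, Pi.smul_apply, smul_smul, add_comm, hβ, smul_eq_mul]
    congr 2; ring
  refine ⟨_, tv_coord_smul_mem_elemPow hn r t hflag b, ?_, ?_, ?_, ?_, ?_⟩
  · rw [vecMul_inv_dotProduct_mulVec, stdv_dot hab]
  · rwa [hga]
  · rwa [hgb]
  · rw [hga, dotProduct_add, dotProduct_smul, dotProduct_single_one, smul_eq_mul, mul_assoc]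
    exact ht3
  · rw [hgb, add_dotProduct, smul_dotProduct, single_one_dotProduct, smul_eq_mul, mul_assoc]
    exact ht4

end Approximation

section Construction

variable {n : ℕ} {d : Proj n → Proj n → ℝ}

/-- `s` is a rank-1 unipotent which plays ping-pong at scale `η`, close at scale `ρ` to the flag
`P ⊆ L` but in general position with respect to it at scale `η`. -/
structure FlagStep (d : Proj n → Proj n → ℝ) (P L : Set (Proj n)) (ρ η : ℝ) (s : SLZ n) :
    Prop where
  pos : 0 < η
  le : η ≤ ρ
  unip : IsR1U s
  att_subset : oThick d (attSet s) η ⊆ oThick d P ρ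
  fix_subset : oThick d (fixSet s) η ⊆ oThick d L ρ
  att_disjoint : oThick d (attSet s) η ∩ oThick d L η = ∅
  fix_disjoint : oThick d P η ∩ oThick d (fixSet s) η = ∅
  contracts : Contracts d s η η

lemma NearFlag.exists_flagStep (hd : IsCompatMetric d) {p ψ : Fin n → ℤ} (hp : p ≠ 0)
    (hpψ : ψ ⬝ᵥ p = 0) {ρ : ℝ} (hρ : 0 < ρ) {X Φ : Fin n → ℤ}
    (h : NearFlag p ψ (coneOf (oThick d {Projectivization.mk ℝ (toR p) (toR_ne_zero hp)} (ρ / 2)))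
      (covecsIn (oThick d (projSet (kerOf (toR ψ))) (ρ / 2))) X Φ) :
    ∃ η, ∃ M : ℕ, 0 < M ∧ ∀ m : ℤ, (M : ℤ) ≤ |m| →
      FlagStep d {Projectivization.mk ℝ (toR p) (toR_ne_zero hp)} (projSet (kerOf (toR ψ))) ρ η
        (tv (m • X) Φ) := by
  obtain ⟨hflag, hC, hD, hl, hr⟩ := h
  have hX : X ≠ 0 := by rintro rfl; exact hl (dotProduct_zero ψ)
  have hΦ : Φ ≠ 0 := by rintro rfl; exact hr (zero_dotProduct p)
  have ne : ∀ {x φ : Fin n → ℤ} (hx : x ≠ 0), φ ⬝ᵥ x = 0 → (projSet (kerOf (toR φ))).Nonempty :=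
    fun hx h => ⟨_, (mk_mem_projSet (toR_ne_zero hx)).2 (mem_kerOf.2 (toR_dotProduct_eq_zero.2 h))⟩
  have notMem : ∀ {x φ : Fin n → ℤ} (hx : x ≠ 0), φ ⬝ᵥ x ≠ 0 →
      Projectivization.mk ℝ (toR x) (toR_ne_zero hx) ∉ projSet (kerOf (toR φ)) :=
    fun hx h h' => h (toR_dotProduct_eq_zero.1 ((mk_mem_projSet (toR_ne_zero hx)).1 h'))
  obtain ⟨η₁, hη₁, h₁⟩ := exists_oThick_disjoint hd (ne hp hpψ) (isClosed_projSet_kerOf _)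
    (notMem hX hl)
  obtain ⟨η₂, hη₂, h₂⟩ := exists_oThick_disjoint hd (ne hX hflag) (isClosed_projSet_kerOf _)
    (notMem hp hr)
  set η := min (ρ / 2) (min η₁ η₂) with hη
  have hηpos : 0 < η := lt_min (by linarith) (lt_min hη₁ hη₂)
  have hηρ : η ≤ ρ / 2 := min_le_left _ _
  obtain ⟨M, hM, hc⟩ := exists_contracts_tv hd hflag hX hΦ hηpos hηpos
  refine ⟨η, M, hM, fun m hm => ?_⟩
  have hm0 : m ≠ 0 := by
    rintro rfl
    rw [abs_zero] at hm
    omega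
  have hmX := smul_ne_zero hm0 hX
  have hflag' := dotProduct_zsmul_eq_zero hflag m
  have hatt : attSet (tv (m • X) Φ) = {Projectivization.mk ℝ (toR X) (toR_ne_zero hX)} := by
    rw [attSet_tv hflag' hmX hΦ, mk_toR_smul hX hm0]
  have hfix := fixSet_tv hflag' hmX
  refine ⟨hηpos, by linarith, isR1U_tv hflag' hmX hΦ, ?_, ?_, ?_, ?_, hc m hm⟩
  · rw [hatt]
    refine (oThick_subset_oThick hd (Set.singleton_nonempty _) (ρ := ρ / 2) ?_
      (Set.singleton_nonempty _)).trans (oThick_mono (by linarith))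
    rw [Set.singleton_subset_iff]
    exact hC.2
  · rw [hfix]
    exact (oThick_subset_oThick hd (ne hX hflag) (ρ := ρ / 2) hD (ne hp hpψ)).trans
      (oThick_mono (by linarith))
  · rw [hatt]
    exact h₁ η ((min_le_right _ _).trans (min_le_left _ _))
  · rw [hfix]
    exact h₂ η ((min_le_right _ _).trans (min_le_right _ _))

/-- If each of countably many tasks can be solved by rank-1 unipotents arbitrarily close to the
flag `P ⊆ L`, then they can be solved by a sequence of elements in ping-pong position. -/
lemma exists_pingPong_sequence {P L : Set (Proj n)} {T : Type*} [Countable T] [Nonempty T]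
    {Solves : T → SLZ n → Prop}
    (step : ∀ ρ > 0, ∀ t, ∃ s η, FlagStep d P L ρ η s ∧ Solves t s) {ε : ℝ} (hε : 0 < ε) :
    ∃ (s : ℕ → SLZ n) (η : ℕ → ℝ), (∀ j, FlagStep d P L ε (η j) (s j)) ∧
      (∀ i j, i ≠ j →
        oThick d (attSet (s i)) (η i) ∩ oThick d (fixSet (s j)) (η j) = ∅) ∧
      ∀ t, ∃ j, Solves t (s j) := by
  obtain ⟨f, hf⟩ := exists_surjective_nat T
  choose s η h hs using step
  let r : ℕ → {x : ℝ // 0 < x} := fun j =>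
    Nat.rec ⟨ε, hε⟩ (fun j ρ => ⟨η ρ.1 ρ.2 (f j), (h ρ.1 ρ.2 (f j)).pos⟩) j
  have hr : ∀ j, FlagStep d P L (r j).1 (r (j + 1)).1 (s (r j).1 (r j).2 (f j)) :=
    fun j => h (r j).1 (r j).2 (f j)
  have hanti : Antitone fun j : ℕ => (r j).1 := antitone_nat_of_succ_le fun j => (hr j).le
  refine ⟨fun j => s (r j).1 (r j).2 (f j), fun j => (r (j + 1)).1, fun j => ?_, fun i j hij => ?_,
    fun t => ?_⟩
  · have h0 : (r j).1 ≤ ε := hanti (Nat.zero_le j)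
    obtain ⟨a, b, c, e, e', g, g', m⟩ := hr j
    exact ⟨a, b.trans h0, c, e.trans (oThick_mono h0), e'.trans (oThick_mono h0), g, g', m⟩
  · rcases lt_or_gt_of_ne hij with hlt | hlt
    · exact Set.subset_eq_empty (Set.inter_subset_inter_right _
        ((hr j).fix_subset.trans (oThick_mono (hanti hlt)))) (hr i).att_disjoint
    · exact Set.subset_eq_empty (Set.inter_subset_inter_left _
        ((hr i).att_subset.trans (oThick_mono (hanti hlt)))) (hr j).fix_disjoint
  · obtain ⟨j, rfl⟩ := hf t
    exact ⟨j, hs _ _ _⟩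

lemma isSchottky_range {ι : Type*} [Nonempty ι] {u : ι → SLZ n} {E D : ι → ℝ} {A R : Set (Proj n)}
    (hu : ∀ i, IsR1U (u i)) (hE : ∀ i, 0 < E i) (hED : ∀ i, E i ≤ D i)
    (hc : ∀ i, Contracts d (u i) (E i) (D i))
    (hdisj : ∀ i j, i ≠ j →
      oThick d (attSet (u i)) (E i) ∩ oThick d (fixSet (u j)) (D j) = ∅)
    (hA : ∀ i, oThick d (attSet (u i)) (E i) ⊆ A) (hR : ∀ i, oThick d (fixSet (u i)) (D i) ⊆ R)
    (hAR : A ⊆ R) (hAc : IsClosed A) (hRc : IsClosed R) : IsSchottky d (Set.range u) A R := by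
  refine ⟨Set.range_nonempty u, ?_, hAR, hAc, hRc, ?_⟩
  · rintro _ ⟨i, rfl⟩; exact hu i
  have key : ∀ v ∈ Set.range u, u (Function.invFun u v) = v := fun v hv => Function.invFun_eq hv
  refine ⟨fun v => E (Function.invFun u v), fun v => D (Function.invFun u v),
    fun v _ => ⟨hE _, hED _⟩, fun v hv => ?_, fun v hv w hw hvw => ?_, fun v hv => ?_,
    fun v hv => ?_⟩
  · have := hc (Function.invFun u v)
    rwa [key v hv] at this
  · have := hdisj (Function.invFun u v) (Function.invFun u w) fun h => hvw <| by
      rw [← key v hv, ← key w hw, h]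
    rwa [key v hv, key w hw] at this
  · have := hA (Function.invFun u v)
    rwa [key v hv] at this
  · have := hR (Function.invFun u v)
    rwa [key v hv] at this

/-- The tasks to be solved by rank-1 unipotents close to a given flag `(p, ψ)`: being conjugate by
an element of `elemPow n r` to a power congruent to `1` modulo `r` of a given elementary matrix;
being a transvection along `j p + z` for some `j`, with a covector that does not kill `p`. -/
def FlagTask (p ψ : Fin n → ℤ) :
    {q : ℕ × Fin n × Fin n // 0 < q.1 ∧ q.2.1 ≠ q.2.2} ⊕ {z : Fin n → ℤ // ψ ⬝ᵥ z ≠ 0} →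
      SLZ n → Prop
  | Sum.inl q, s => ∃ g ∈ elemPow n q.1.1, ∃ t : ℤ,
      s = g * tv (stdv q.1.2.1) (stdv q.1.2.2) ^ (1 + q.1.1 * t) * g⁻¹
  | Sum.inr z, s => ∃ (j m : ℤ) (Φ : Fin n → ℤ), m ≠ 0 ∧
      Φ ⬝ᵥ (j • p + z.1) = 0 ∧ Φ ⬝ᵥ p ≠ 0 ∧ s = tv (m • (j • p + z.1)) Φ

lemma exists_flagStep_flagTask (hn : 3 ≤ n) (hd : IsCompatMetric d) {p ψ : Fin n → ℤ} (hp : p ≠ 0)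
    (hψ : ψ ≠ 0) (hpψ : ψ ⬝ᵥ p = 0) {ρ : ℝ} (hρ : 0 < ρ)
    (t : {q : ℕ × Fin n × Fin n // 0 < q.1 ∧ q.2.1 ≠ q.2.2} ⊕ {z : Fin n → ℤ // ψ ⬝ᵥ z ≠ 0}) :
    ∃ s η, FlagStep d {Projectivization.mk ℝ (toR p) (toR_ne_zero hp)} (projSet (kerOf (toR ψ)))
      ρ η s ∧ FlagTask p ψ t s := by
  set P : Set (Proj n) := {Projectivization.mk ℝ (toR p) (toR_ne_zero hp)} with hP
  set L := projSet (kerOf (toR ψ)) with hL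
  have hLne : L.Nonempty :=
    ⟨_, (mk_mem_projSet (toR_ne_zero hp)).2 (mem_kerOf.2 (toR_dotProduct_eq_zero.2 hpψ))⟩
  have hPo : IsOpen (oThick d P (ρ / 2)) := isOpen_oThick hd (Set.singleton_nonempty _)
  have hLo : IsOpen (oThick d L (ρ / 2)) := isOpen_oThick hd hLne
  have hC := isOpen_coneOf hPo
  have hpC : toR p ∈ coneOf (oThick d P (ρ / 2)) :=
    ⟨toR_ne_zero hp, subset_oThick hd (by linarith) rfl⟩
  have hD : covecsIn (oThick d L (ρ / 2)) ∈ nhds (toR ψ) :=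
    covecsIn_mem_nhds hLo (subset_oThick hd (by linarith))
  rcases t with ⟨⟨r, a, b⟩, hr, hab⟩ | ⟨z, hz⟩
  · obtain ⟨g, hg, hN⟩ := exists_conj_nearFlag hn hp hψ hpψ hC hpC (scaleInv_coneOf _) hD
      (scaleInv_covecsIn _) (fun φ hφ _ => covecsIn_mem_nhds hLo hφ) hr hab
    obtain ⟨η, M, -, hM⟩ := hN.exists_flagStep hd hp hpψ hρ
    refine ⟨_, η, hM (1 + r * M) ?_, g, hg, M, ?_⟩
    · refine le_trans ?_ (le_abs_self _)
      have hr' : 0 < r := hr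
      nlinarith
    · have h0 := stdv_dot hab
      rw [tv_zpow h0, tv_conj g (dotProduct_zsmul_eq_zero h0 _), mulVec_smul]
  · have hμ : p ⬝ᵥ p ≠ 0 := fun h => hp (dotProduct_self_eq_zero.1 h)
    obtain ⟨j, hN⟩ := (eventually_nearFlag hpψ (hC.mem_nhds hpC) (scaleInv_coneOf _) hD
      (scaleInv_covecsIn _) hz hμ).exists
    obtain ⟨η, M, hM0, hM⟩ := hN.exists_flagStep hd hp hpψ hρ
    exact ⟨_, η, hM M (le_abs_self _), j, M, _, by exact_mod_cast hM0.ne', hN.flag, hN.right, rfl⟩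

lemma approxElem_of_flagTask {Δ : Subgroup (SLZ n)} {p ψ : Fin n → ℤ}
    (h : ∀ t, ∃ s ∈ Δ, FlagTask p ψ t s) : ApproxElem Δ := by
  intro r hr a b hab
  obtain ⟨_, hs, g, hg, t, rfl⟩ := h (Sum.inl ⟨(r, a, b), hr, hab⟩)
  exact ⟨g, hg, t, hs⟩

lemma fullCov_of_flagTask {Δ : Subgroup (SLZ n)} {p φ ψ z : Fin n → ℤ}
    (h : ∀ t, ∃ s ∈ Δ, FlagTask p ψ t s) (hp : TVIn Δ p φ) (hφz : φ ⬝ᵥ z = 0)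
    (hz : ψ ⬝ᵥ z ≠ 0) : FullCov Δ φ := by
  have key : ∀ y, φ ⬝ᵥ y = 0 → ψ ⬝ᵥ y ≠ 0 → TVIn Δ y φ := by
    intro y hy hψy
    obtain ⟨_, hs, j, m, Φ, hm, hX, hΦ, rfl⟩ := h (Sum.inr ⟨y, hψy⟩)
    have h1 := TVIn.commutator hp ⟨hX, m, hm, hs⟩
      (by rw [dotProduct_add, dotProduct_zsmul_eq_zero hp.1, hy, zero_add]) hΦ
    have h2 := h1.add_left (hp.smul_left (-j))
    rwa [neg_smul, add_neg_cancel_comm] at h2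
  intro y hy
  by_cases hψy : ψ ⬝ᵥ y = 0
  · have h1 := key (y + z) (by rw [dotProduct_add, hy, hφz, add_zero])
      (by rwa [dotProduct_add, hψy, zero_add])
    have h2 := h1.add_left ((key z hφz hz).smul_left (-1))
    rwa [neg_smul, one_smul, add_neg_cancel_right] at h2
  · exact key y hy hψy

lemma not_isR1U_one : ¬ IsR1U (1 : SLZ n) := by
  rintro ⟨-, h⟩
  have : linQ (1 : SLZ n) = 0 := by
    rw [linQ, show matQ (1 : SLZ n) = 1 by rw [matQ, map_one]; rfl, sub_self, mulVecLin_zero]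
  rw [this, LinearMap.range_zero, finrank_bot] at h
  exact zero_ne_one h

lemma exists_act_mk_toR (g : SLZ n) {x : Fin n → ℤ} (hx : x ≠ 0) :
    ∃ h : g.1 *ᵥ x ≠ 0, act g (Projectivization.mk ℝ (toR x) (toR_ne_zero hx)) =
      Projectivization.mk ℝ (toR (g.1 *ᵥ x)) (toR_ne_zero h) := by
  have h : g.1 *ᵥ x ≠ 0 := by
    intro h
    apply matR_mulVec_ne_zero g (toR_ne_zero hx)
    rw [matR_mulVec, h]
    ext i
    simp [toR]
  refine ⟨h, ?_⟩
  rw [act_mk]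
  congr 1
  exact matR_mulVec g x

lemma vecMul_ne_zero_of_SLZ (g : SLZ n) {φ : Fin n → ℤ} (hφ : φ ≠ 0) : φ ᵥ* g.1 ≠ 0 := by
  intro h
  have := congrArg (· ᵥ* (g⁻¹ : SLZ n).1) h
  simp only [zero_vecMul, vecMul_vecMul, ← SLZ.coe_mul, mul_inv_cancel, SLZ.coe_one,
    vecMul_one] at this
  exact hφ this

lemma attSet_tv_smul {x φ : Fin n → ℤ} (h : φ ⬝ᵥ x = 0) (hx : x ≠ 0) (hφ : φ ≠ 0) {m : ℤ}
    (hm : m ≠ 0) :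
    attSet (tv (m • x) φ) = {Projectivization.mk ℝ (toR x) (toR_ne_zero hx)} := by
  rw [attSet_tv (dotProduct_zsmul_eq_zero h m) (smul_ne_zero hm hx) hφ, mk_toR_smul hx hm]

lemma fixSet_tv_smul {x φ : Fin n → ℤ} (h : φ ⬝ᵥ x = 0) (hx : x ≠ 0) {m : ℤ} (hm : m ≠ 0) :
    fixSet (tv (m • x) φ) = projSet (kerOf (toR φ)) :=
  fixSet_tv (dotProduct_zsmul_eq_zero h m) (smul_ne_zero hm hx)

end Construction

/-- Lemma 2.13 (starting): given `k ∈ SL(n,ℤ)` and rational flags `p_i ∈ L_i`,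
`i = 1,2,3`, with `[p_i]_ε ∩ [L_j]_δ = ∅` for `i ≠ j`, `p₂ = k•p₁`, `p₃ = k²•p₁`,
`L₂ = k•L₁`, `L₃ ≠ k²•L₁`, there is a Schottky system `(S, 𝒜, ℛ)` whose generated
subgroup `H` is profinitely dense, `H ∩ kHk⁻¹ ≠ {id}`, and `⟨S, k⟩ = SL(n,ℤ)`. -/
theorem schottky_starting (n : ℕ) (hn : 3 ≤ n) (k : SLZ n)
    (d : Proj n → Proj n → ℝ) (hd : IsCompatMetric d)
    (ε δ : ℝ) (hε : 0 < ε) (hεδ : ε ≤ δ)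
    (p₁ p₂ p₃ : Proj n) (hp₁ : RatPoint p₁) (hp₂ : RatPoint p₂) (hp₃ : RatPoint p₃)
    (W₁ W₂ W₃ : Submodule ℝ (Fin n → ℝ))
    (hW₁ : IsRatSubmodule W₁) (hW₂ : IsRatSubmodule W₂) (hW₃ : IsRatSubmodule W₃)
    (hW₁rank : Module.finrank ℝ W₁ = n - 1) (hW₂rank : Module.finrank ℝ W₂ = n - 1)
    (hW₃rank : Module.finrank ℝ W₃ = n - 1)
    (hpW₁ : p₁.submodule ≤ W₁) (hpW₂ : p₂.submodule ≤ W₂) (hpW₃ : p₃.submodule ≤ W₃)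
    (h12 : cThick d {p₁} ε ∩ cThick d (projSet W₂) δ = ∅)
    (h13 : cThick d {p₁} ε ∩ cThick d (projSet W₃) δ = ∅)
    (h21 : cThick d {p₂} ε ∩ cThick d (projSet W₁) δ = ∅)
    (h23 : cThick d {p₂} ε ∩ cThick d (projSet W₃) δ = ∅)
    (h31 : cThick d {p₃} ε ∩ cThick d (projSet W₁) δ = ∅)
    (h32 : cThick d {p₃} ε ∩ cThick d (projSet W₂) δ = ∅)
    (hk1 : p₂ = act k p₁) (hk2 : p₃ = act (k ^ 2) p₁)
    (hk3 : W₂ = actSub k W₁) (hk4 : W₃ ≠ actSub (k ^ 2) W₁) :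
    ∃ S : Set (SLZ n),
      IsSchottky d S (cThick d {p₁} ε ∪ cThick d {p₂} ε ∪ cThick d {p₃} ε)
        (cThick d (projSet W₁) δ ∪ cThick d (projSet W₂) δ ∪ cThick d (projSet W₃) δ) ∧
      ProfinitelyDense (Subgroup.closure S) ∧
      Subgroup.closure S ⊓
        Subgroup.map (MulAut.conj k).toMonoidHom (Subgroup.closure S) ≠ ⊥ ∧
      Subgroup.closure (S ∪ {k}) = ⊤ := by
  obtain ⟨x, hx, rfl⟩ := hp₁.exists_int
  obtain ⟨φ, hφ, rfl⟩ := hW₁.exists_int (by omega) hW₁rank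
  obtain ⟨ψ, hψ, rfl⟩ := hW₃.exists_int (by omega) hW₃rank
  obtain ⟨hy, hxy⟩ := exists_act_mk_toR k hx
  obtain ⟨hz, hxz⟩ := exists_act_mk_toR (k ^ 2) hx
  rw [actSub_kerOf] at hk3 hk4
  obtain rfl := hk1.trans hxy
  obtain rfl := hk2.trans hxz
  subst hk3
  have hφx : φ ⬝ᵥ x = 0 := toR_dotProduct_eq_zero.1 ((mk_mem_projSet (toR_ne_zero hx)).1 hpW₁)
  have hψp := toR_dotProduct_eq_zero.1 ((mk_mem_projSet (toR_ne_zero hz)).1 hpW₃)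
  have hχy := (vecMul_inv_dotProduct_mulVec k x φ).trans hφx
  have hχ := vecMul_ne_zero_of_SLZ k⁻¹ hφ
  have hφ' := vecMul_ne_zero_of_SLZ (k ^ 2)⁻¹ hφ
  obtain ⟨z, hφz, hψz⟩ := exists_dotProduct_ne_zero hφ' hψ hk4
  have hδ : 0 < δ := hε.trans_le hεδ
  obtain ⟨M₁, hM₁, hc₁⟩ := exists_contracts_tv hd hφx hx hφ hε hδ
  obtain ⟨M₂, hM₂, hc₂⟩ := exists_contracts_tv hd hχy hy hχ hε hδ
  set m : ℤ := M₁ + M₂ with hm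
  have hm0 : m ≠ 0 := by omega
  have : Nonempty ({q : ℕ × Fin n × Fin n // 0 < q.1 ∧ q.2.1 ≠ q.2.2} ⊕
      {z : Fin n → ℤ // ψ ⬝ᵥ z ≠ 0}) := ⟨Sum.inr ⟨z, hψz⟩⟩
  obtain ⟨s, η, hs, hss, hsolve⟩ := exists_pingPong_sequence
    (fun ρ hρ t => exists_flagStep_flagTask hn hd hz hψ hψp hρ t) hε
  set u₁ := tv (m • x) φ with hu₁
  set u₂ := tv (m • (k.1 *ᵥ x)) (φ ᵥ* (k⁻¹ : SLZ n).1) with hu₂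
  have hconj : k * u₁ * k⁻¹ = u₂ := by
    rw [hu₁, tv_conj k (dotProduct_zsmul_eq_zero hφx m), mulVec_smul]
  have hr₁ : IsR1U u₁ := isR1U_tv (dotProduct_zsmul_eq_zero hφx m) (smul_ne_zero hm0 hx) hφ
  have hr₂ : IsR1U u₂ := isR1U_tv (dotProduct_zsmul_eq_zero hχy m) (smul_ne_zero hm0 hy) hχ
  have a₁ : oThick d (attSet u₁) ε ⊆
      cThick d {Projectivization.mk ℝ (toR x) (toR_ne_zero hx)} ε := by
    rw [attSet_tv_smul hφx hx hφ hm0]; exact oThick_subset_cThick le_rfl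
  have a₂ : oThick d (attSet u₂) ε ⊆
      cThick d {Projectivization.mk ℝ (toR (k.1 *ᵥ x)) (toR_ne_zero hy)} ε := by
    rw [attSet_tv_smul hχy hy hχ hm0]; exact oThick_subset_cThick le_rfl
  have a₃ := fun j => (hs j).att_subset.trans (oThick_subset_cThick le_rfl)
  have f₁ : oThick d (fixSet u₁) δ ⊆ cThick d (projSet (kerOf (toR φ))) δ := by
    rw [fixSet_tv_smul hφx hx hm0]; exact oThick_subset_cThick le_rfl
  have f₂ : oThick d (fixSet u₂) δ ⊆ cThick d (projSet (kerOf (toR (φ ᵥ* (k⁻¹ : SLZ n).1)))) δ := by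
    rw [fixSet_tv_smul hχy hy hm0]; exact oThick_subset_cThick le_rfl
  have f₃ := fun j => (hs j).fix_subset.trans (oThick_subset_cThick hεδ)
  have disj : ∀ {A A' B B' : Set (Proj n)}, A ⊆ A' → B ⊆ B' → A' ∩ B' = ∅ → A ∩ B = ∅ :=
    fun hA hB h => Set.subset_eq_empty (Set.inter_subset_inter hA hB) h
  have sub : ∀ {q : Proj n} {W : Submodule ℝ (Fin n → ℝ)}, q.submodule ≤ W →
      cThick d {q} ε ⊆ cThick d (projSet W) δ := fun h =>
    (cThick_subset hd (Set.singleton_nonempty _) (Set.singleton_subset_iff.2 h)).trans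
      (cThick_mono hεδ)
  set u : Bool ⊕ ℕ → SLZ n := Sum.elim (fun b => bif b then u₁ else u₂) s with hu
  have mem₁ : u₁ ∈ Set.range u := ⟨Sum.inl true, rfl⟩
  have mem₂ : u₂ ∈ Set.range u := ⟨Sum.inl false, rfl⟩
  have hΔ : ∀ Δ, Subgroup.closure (Set.range u) ≤ Δ → ∀ t,
      ∃ v ∈ Δ, FlagTask ((k ^ 2).1 *ᵥ x) ψ t v := by
    intro Δ hle t
    obtain ⟨j, hj⟩ := hsolve t
    exact ⟨s j, hle (Subgroup.subset_closure ⟨Sum.inr j, rfl⟩), hj⟩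
  refine ⟨Set.range u, ?_, profinitelyDense_of_approxElem (approxElem_of_flagTask (hΔ _ le_rfl)),
    ?_, ?_⟩
  · refine isSchottky_range (E := Sum.elim (fun _ => ε) η) (D := Sum.elim (fun _ => δ) η)
      ?_ ?_ ?_ ?_ ?_ ?_ ?_ ?_ ?_ ?_
    · rintro ((_ | _) | j)
      exacts [hr₂, hr₁, (hs j).unip]
    · rintro (_ | j)
      exacts [hε, (hs j).pos]
    · rintro (_ | j)
      exacts [hεδ, le_rfl]
    · have hle : (m : ℤ) ≤ |m| := le_abs_self m
      rintro ((_ | _) | j)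
      exacts [hc₂ m (by omega), hc₁ m (by omega), (hs j).contracts]
    · rintro ((_ | _) | i) ((_ | _) | j) hij
      exacts [absurd rfl hij, disj a₂ f₁ h21, disj a₂ (f₃ j) h23, disj a₁ f₂ h12, absurd rfl hij,
        disj a₁ (f₃ j) h13, disj (a₃ i) f₂ h32, disj (a₃ i) f₁ h31,
        hss i j fun h => hij (congrArg Sum.inr h)]
    · rintro ((_ | _) | j)
      exacts [a₂.trans fun _ h => Or.inl (Or.inr h), a₁.trans fun _ h => Or.inl (Or.inl h),
        (a₃ j).trans fun _ h => Or.inr h]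
    · rintro ((_ | _) | j)
      exacts [f₂.trans fun _ h => Or.inl (Or.inr h), f₁.trans fun _ h => Or.inl (Or.inl h),
        (f₃ j).trans fun _ h => Or.inr h]
    · exact Set.union_subset_union (Set.union_subset_union (sub hpW₁) (sub hpW₂)) (sub hpW₃)
    · exact ((isClosed_cThick hd (Set.singleton_nonempty _)).union
        (isClosed_cThick hd (Set.singleton_nonempty _))).union
        (isClosed_cThick hd (Set.singleton_nonempty _))
    · exact ((isClosed_cThick hd ⟨_, hpW₁⟩).union (isClosed_cThick hd ⟨_, hpW₂⟩)).union
        (isClosed_cThick hd ⟨_, hpW₃⟩)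
  · rw [ne_eq, Subgroup.eq_bot_iff_forall, not_forall]
    refine ⟨u₂, fun h => ?_⟩
    rw [h ⟨Subgroup.subset_closure mem₂, u₁, Subgroup.subset_closure mem₁, hconj⟩] at hr₂
    exact not_isR1U_one hr₂
  · have hle : Subgroup.closure (Set.range u) ≤ Subgroup.closure (Set.range u ∪ {k}) :=
      Subgroup.closure_mono Set.subset_union_left
    have hk : k ∈ Subgroup.closure (Set.range u ∪ {k}) :=
      Subgroup.subset_closure (Or.inr rfl)
    have h1 : TVIn (Subgroup.closure (Set.range u ∪ {k})) x φ :=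
      ⟨hφx, m, hm0, hle (Subgroup.subset_closure mem₁)⟩
    exact eq_top_of_fullCov hn (approxElem_of_flagTask (hΔ _ hle))
      (fullCov_of_flagTask (hΔ _ hle) (h1.conj (pow_mem hk 2)) hφz hψz) hφ'
end

section
/- Let n ≥ 3. There exist a maximal subgroup M of PSL(n,ℚ) of infinite index and an element g ∈ PSL(n,ℚ) such that M ∩ gMg⁻¹ = {id}. -/
/- Common setup: `SL(n,ℤ)`, `SL(n,ℝ)`, the real projective space `ℙ^{n-1}(ℝ)`
with its quotient topology and the projective action, rank-1 unipotent elements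
and their attracting points / fixed hyperplanes, metrics compatible with the
topology of `ℙ`, `ε`-neighbourhoods, Schottky systems, profinite density,
maximal subgroups, and lattices in `SL(n,ℝ)`. -/

open Matrix LinearAlgebra.Projectivization

abbrev SLQ (n : ℕ) := Matrix.SpecialLinearGroup (Fin n) ℚ

abbrev PSLQ (n : ℕ) := SLQ n ⧸ Subgroup.center (SLQ n)

@[to_additive]
theorem prod_eq_mul_mul_of_ne {ι M : Type*} [Fintype ι] [DecidableEq ι] [CommMonoid M]
    {i j k : ι} (hij : i ≠ j) (hik : i ≠ k) (hjk : j ≠ k) (f : ι → M)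
    (hf : ∀ m, m ≠ i → m ≠ j → m ≠ k → f m = 1) : ∏ m, f m = f i * f j * f k := by
  rw [← Finset.prod_subset (Finset.subset_univ {i, j, k}) (fun m _ hm => by
    simp only [Finset.mem_insert, Finset.mem_singleton, not_or] at hm
    exact hf m hm.1 hm.2.1 hm.2.2)]
  rw [Finset.prod_insert (by simp [hij, hik]), Finset.prod_insert (by simp [hjk]),
    Finset.prod_singleton, mul_assoc]

theorem exists_fin_ne_ne {n : ℕ} (hn : 3 ≤ n) (i k : Fin n) : ∃ j, j ≠ i ∧ j ≠ k := by
  obtain ⟨j, -, hj⟩ := Finset.exists_mem_notMem_of_card_lt_card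
    (s := {i, k}) (t := (Finset.univ : Finset (Fin n)))
    (lt_of_le_of_lt (Finset.card_le_two) (by rw [Finset.card_univ, Fintype.card_fin]; omega))
  simp only [Finset.mem_insert, Finset.mem_singleton, not_or] at hj
  exact ⟨j, hj⟩

theorem exists_one_lt_inv_pow_sub_one_notMem {n : ℕ} (hn : n ≠ 0) {B : Set ℚ} (hB : B.Finite) :
    ∃ t : ℚ, 1 < t ∧ (t ^ n - 1)⁻¹ ∉ B := by
  have hinj : Function.Injective fun m : ℕ => (((m + 2 : ℚ)) ^ n - 1)⁻¹ := by
    intro a b hab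
    have h := sub_left_injective (inv_injective hab)
    have := (pow_left_inj₀ (by positivity) (by positivity) hn).1 h
    exact_mod_cast add_right_cancel this
  obtain ⟨_, ⟨m, rfl⟩, hm⟩ := (Set.infinite_range_of_injective hinj).exists_notMem_finite hB
  exact ⟨m + 2, by linarith [(m.cast_nonneg : (0 : ℚ) ≤ m)], hm⟩

theorem finite_setOf_sextic_eq_zero {q : ℚ} (hq : q ≠ 0) (s w : ℚ) :
    {r : ℚ | 8 * r ^ 3 * ((s + q + w + r) * (s - r) ^ 3
        - (s + q - w - r) * (r + s) ^ 3)
      + q * (r ^ 2 - s ^ 2) ^ 3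
      - (2 * s + 3 * q) * (4 * r ^ 2 * (r ^ 2 - s ^ 2) ^ 2) = 0}.Finite := by
  let P : Polynomial ℚ := 8 * .X ^ 3 * ((.C (s + q + w) + .X) * (.C s - .X) ^ 3
      - (.C (s + q - w) - .X) * (.X + .C s) ^ 3)
      + .C q * (.X ^ 2 - .C (s ^ 2)) ^ 3
      - .C (2 * s + 3 * q) * (4 * .X ^ 2 * (.X ^ 2 - .C (s ^ 2)) ^ 2)
  have hP : P ≠ 0 := by
    intro h
    have h0 : P.eval 0 = 0 := by simp [h]
    have h1 : P.eval 1 = 0 := by simp [h]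
    simp [P] at h0 h1
    have hs : s = 0 := by tauto
    subst hs
    apply hq
    norm_num at h1
    linarith
  refine (Polynomial.finite_setOfPred_isRoot hP).subset fun r hr => ?_
  simp only [Set.mem_ofPred_eq] at hr
  simp only [Set.mem_ofPred_eq, Polynomial.IsRoot.def]
  rw [← hr]
  simp [P]

theorem exists_torus_of_ne_zero {n : ℕ} (hn : 3 ≤ n) {p : Fin n → ℚ} (hp : ∑ m, p m = 1)
    {i j k : Fin n} (hik : i ≠ k) (hij : i ≠ j) (hkj : k ≠ j) (hpj : p j ≠ 0) :
    ∃ t s z : ℚ, ∃ d : Fin n → ℚ, t ≠ 0 ∧ s ≠ 0 ∧ z ≠ 0 ∧ ∏ m, d m = z ^ n ∧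
      (t ^ n - 1) * d i + (s ^ n - 1) * d k
        + (t ^ n - 1) * (s ^ n - 1) * ∑ m, p m * d m = 0 ∧
      ((s ^ n)⁻¹ - 1) * (d k)⁻¹ + ((t ^ n)⁻¹ - 1) * (d i)⁻¹
        + ((s ^ n)⁻¹ - 1) * ((t ^ n)⁻¹ - 1) * ∑ m, p m * (d m)⁻¹ ≠ 0 := by
  obtain ⟨σ, hσ⟩ : ∃ σ, σ = (p i + p k - 1) / 2 - p j := ⟨_, rfl⟩
  obtain ⟨w, hw⟩ : ∃ w, w = p i - p k := ⟨_, rfl⟩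
  obtain ⟨c, hc⟩ : ∃ c, c = (1 - w) / 2 := ⟨_, rfl⟩
  have hfin := ((finite_setOf_sextic_eq_zero hpj σ w).union
    (Set.toFinite {0, σ, -σ})).preimage (add_left_injective c).injOn
  obtain ⟨t, ht, hτ⟩ := exists_one_lt_inv_pow_sub_one_notMem (n := n) (by omega) hfin
  have ht0 : 0 < t := by linarith
  have hT : 1 < t ^ n := one_lt_pow₀ ht (by omega)
  obtain ⟨r, hr⟩ : ∃ r, r = (t ^ n - 1)⁻¹ + c := ⟨_, rfl⟩
  simp only [Set.mem_preimage, ← hr, Set.mem_union, Set.mem_ofPred_eq, Set.mem_insert_iff,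
    Set.mem_singleton_iff, not_or] at hτ
  obtain ⟨hG, hr0, hrσ, hrσ'⟩ := hτ
  have e1 : r - σ ≠ 0 := sub_ne_zero.2 hrσ
  have e2 : r + σ ≠ 0 := fun h => hrσ' (by linarith)
  let dk : ℚ := (r - σ) ^ 2 / ((r + σ) * (-2 * r))
  let di : ℚ := (r + σ) ^ 2 / ((r - σ) * (-2 * r))
  let dj : ℚ := (2 * r) ^ 2 / ((r - σ) * (r + σ))
  let d : Fin n → ℚ := fun m => if m = i then di else if m = k then dk else
    if m = j then dj else 1
  have hdi : d i = di := by simp [d]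
  have hdk : d k = dk := by simp [d, hik.symm]
  have hdj : d j = dj := by simp [d, hij.symm, hkj.symm]
  have hd1 : ∀ m, m ≠ i → m ≠ k → m ≠ j → d m = 1 := fun m h1 h2 h3 => by simp [d, h1, h2, h3]
  have hsum1 : ∑ m, p m * d m = 1 + (p i * (di - 1) + p k * (dk - 1) + p j * (dj - 1)) := by
    have := sum_eq_add_add_of_ne hik hij hkj (fun m => p m * (d m - 1))
      (fun m h1 h2 h3 => by simp [hd1 m h1 h2 h3])
    simp only [mul_sub, mul_one, Finset.sum_sub_distrib, hp, hdi, hdk, hdj] at this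
    linear_combination this
  have hsum2 : ∑ m, p m * (d m)⁻¹
      = 1 + (p i * (di⁻¹ - 1) + p k * (dk⁻¹ - 1) + p j * (dj⁻¹ - 1)) := by
    have := sum_eq_add_add_of_ne hik hij hkj (fun m => p m * ((d m)⁻¹ - 1))
      (fun m h1 h2 h3 => by simp [hd1 m h1 h2 h3])
    simp only [mul_sub, mul_one, Finset.sum_sub_distrib, hp, hdi, hdk, hdj] at this
    linear_combination this
  obtain ⟨τ, hτ⟩ : ∃ τ, τ = (t ^ n - 1)⁻¹ := ⟨_, rfl⟩
  have hτ0 : 0 < τ := hτ ▸ inv_pos.2 (sub_pos.2 hT)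
  have hτ1 : τ + 1 ≠ 0 := by positivity
  have hθ : t ^ n - 1 = τ⁻¹ := by rw [hτ, inv_inv]
  have hθ' : (t ^ n)⁻¹ - 1 = -(τ + 1)⁻¹ := by
    rw [show t ^ n = (τ + 1) / τ by field_simp; linear_combination τ * hθ + mul_inv_cancel₀ hτ0.ne']
    field_simp
    ring
  rw [← hτ] at hr
  have hpi : p i = σ + p j + 1 + τ - r := by rw [hr, hσ, hc, hw]; ring
  have hpk : p k = σ + p j + r - τ := by rw [hr, hσ, hc, hw]; ring
  have hw' : w = 2 * τ - 2 * r + 1 := by rw [hr, hc]; ring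
  refine ⟨t, t⁻¹, 1, d, ht0.ne', inv_ne_zero ht0.ne', one_ne_zero, ?_, ?_, ?_⟩
  · rw [prod_eq_mul_mul_of_ne hik hij hkj d hd1, hdi, hdk, hdj, one_pow]
    simp only [di, dk, dj]
    field_simp
  · rw [hsum1, hdi, hdk, inv_pow, hθ, hθ', hpi, hpk]
    simp only [di, dk, dj]
    field_simp
    ring
  · rw [hsum2, hdi, hdk, inv_pow, inv_inv, hθ, hθ', hpi, hpk]
    intro h
    apply hG
    rw [← mul_zero (-(τ * (τ + 1) * (4 * r ^ 2 * (r ^ 2 - σ ^ 2) ^ 2))), ← h, hw']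
    simp only [di, dk, dj]
    have e3 : r ^ 2 - σ ^ 2 = (r - σ) * (r + σ) := by ring
    rw [e3]
    field_simp
    ring

theorem exists_torus_of_eq_zero {n : ℕ} (hn : 3 ≤ n) {p : Fin n → ℚ}
    {i k : Fin n} (hik : i ≠ k) (hpik : p i + p k = 1) (hp : ∀ m, m ≠ i → m ≠ k → p m = 0) :
    ∃ t s z : ℚ, ∃ d : Fin n → ℚ, t ≠ 0 ∧ s ≠ 0 ∧ z ≠ 0 ∧ ∏ m, d m = z ^ n ∧
      (t ^ n - 1) * d i + (s ^ n - 1) * d k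
        + (t ^ n - 1) * (s ^ n - 1) * ∑ m, p m * d m = 0 ∧
      ((s ^ n)⁻¹ - 1) * (d k)⁻¹ + ((t ^ n)⁻¹ - 1) * (d i)⁻¹
        + ((s ^ n)⁻¹ - 1) * ((t ^ n)⁻¹ - 1) * ∑ m, p m * (d m)⁻¹ ≠ 0 := by
  obtain ⟨t, ht, hτ⟩ := exists_one_lt_inv_pow_sub_one_notMem (n := n) (by omega)
    (Set.toFinite {-p k})
  obtain ⟨s, hs, hσ⟩ := exists_one_lt_inv_pow_sub_one_notMem (n := n) (by omega)
    (Set.toFinite {-p i, (t ^ n - 1)⁻¹})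
  have ht0 : 0 < t := by linarith
  have hs0 : 0 < s := by linarith
  have hT : 1 < t ^ n := one_lt_pow₀ ht (by omega)
  have hS : 1 < s ^ n := one_lt_pow₀ hs (by omega)
  obtain ⟨τ, hτe⟩ : ∃ τ, τ = (t ^ n - 1)⁻¹ := ⟨_, rfl⟩
  obtain ⟨σ, hσe⟩ : ∃ σ, σ = (s ^ n - 1)⁻¹ := ⟨_, rfl⟩
  have hτ0 : 0 < τ := hτe ▸ inv_pos.2 (sub_pos.2 hT)
  have hσ0 : 0 < σ := hσe ▸ inv_pos.2 (sub_pos.2 hS)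
  have hθ : t ^ n = (τ + 1) / τ := by
    rw [eq_div_iff hτ0.ne', hτe]
    have := (sub_pos.2 hT).ne'
    field_simp
    ring
  have hφ : s ^ n = (σ + 1) / σ := by
    rw [eq_div_iff hσ0.ne', hσe]
    have := (sub_pos.2 hS).ne'
    field_simp
    ring
  rw [← hτe] at hτ hσ
  rw [← hσe] at hσ
  simp only [Set.mem_insert_iff, Set.mem_singleton_iff, not_or] at hτ hσ
  have hα : p i + σ ≠ 0 := fun h => hσ.1 (by linarith)
  have hβ : p k + τ ≠ 0 := fun h => hτ (by linarith)
  obtain ⟨j, hji, hjk⟩ := exists_fin_ne_ne hn i k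
  let d : Fin n → ℚ := fun m => if m = i then p k + τ else if m = k then -(p i + σ) else
    if m = j then -((p k + τ) * (p i + σ))⁻¹ else 1
  have hdi : d i = p k + τ := by simp [d]
  have hdk : d k = -(p i + σ) := by simp [d, hik.symm]
  have hdj : d j = -((p k + τ) * (p i + σ))⁻¹ := by simp [d, hji, hjk]
  have hd1 : ∀ m, m ≠ i → m ≠ k → m ≠ j → d m = 1 := fun m h1 h2 h3 => by simp [d, h1, h2, h3]
  have hsum : ∀ f : Fin n → ℚ, ∑ m, p m * f m = p i * f i + p k * f k := fun f => by
    rw [sum_eq_add_add_of_ne hik hji.symm hjk.symm _ (fun m h1 h2 _ => by simp [hp m h1 h2]),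
      hp j hji hjk]
    ring
  refine ⟨t, s, 1, d, ht0.ne', hs0.ne', one_ne_zero, ?_, ?_, ?_⟩
  · rw [prod_eq_mul_mul_of_ne hik hji.symm hjk.symm d hd1, hdi, hdk, hdj, one_pow]
    field_simp
  · rw [hsum, hdi, hdk, hθ, hφ]
    field_simp
    ring
  · rw [hsum, hdi, hdk, hθ, hφ]
    intro h
    have hpk : p k = 1 - p i := by linarith
    have hfac : (τ - σ) * (1 + τ + σ) = 0 := by
      rw [← mul_zero ((τ + 1) * (σ + 1) * ((p i + σ) * (p k + τ))), ← h]
      have := hτ0.ne'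
      have := hσ0.ne'
      have : τ + 1 ≠ 0 := by positivity
      have : σ + 1 ≠ 0 := by positivity
      field_simp
      rw [hpk]
      ring
    rcases mul_eq_zero.1 hfac with h | h
    · exact hσ.2 (by linarith)
    · linarith

theorem exists_torus {n : ℕ} (hn : 3 ≤ n) {p : Fin n → ℚ} (hp : ∑ m, p m = 1)
    {i k : Fin n} (hik : i ≠ k) :
    ∃ t s z : ℚ, ∃ d : Fin n → ℚ, t ≠ 0 ∧ s ≠ 0 ∧ z ≠ 0 ∧ ∏ m, d m = z ^ n ∧
      (t ^ n - 1) * d i + (s ^ n - 1) * d k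
        + (t ^ n - 1) * (s ^ n - 1) * ∑ m, p m * d m = 0 ∧
      ((s ^ n)⁻¹ - 1) * (d k)⁻¹ + ((t ^ n)⁻¹ - 1) * (d i)⁻¹
        + ((s ^ n)⁻¹ - 1) * ((t ^ n)⁻¹ - 1) * ∑ m, p m * (d m)⁻¹ ≠ 0 := by
  by_cases h : ∃ j, j ≠ i ∧ j ≠ k ∧ p j ≠ 0
  · obtain ⟨j, hji, hjk, hj⟩ := h
    exact exists_torus_of_ne_zero hn hp hik hji.symm hjk.symm hj
  · push Not at h
    obtain ⟨j, hji, hjk⟩ := exists_fin_ne_ne hn i k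
    refine exists_torus_of_eq_zero hn hik ?_ h
    rw [← hp, sum_eq_add_add_of_ne hik hji.symm hjk.symm p (fun m h1 h2 _ => h m h1 h2),
      h j hji hjk, add_zero]

section Homology

variable {ι F : Type*} [Fintype ι] [DecidableEq ι] [Field F]

/-- The linear map scaling `x` by `θ` and fixing the kernel of `y`, provided `y ⬝ᵥ x = 1`. -/
def homology (x y : ι → F) (θ : F) : Matrix ι ι F :=
  1 + (θ - 1) • vecMulVec x y

theorem homology_mul_homology {x y y' : ι → F} (h : y ⬝ᵥ x = 1) (θ φ : F) :
    homology x y θ * homology x y' φ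
      = 1 + vecMulVec x ((θ - 1) • y + (θ * (φ - 1)) • y') := by
  simp only [homology, mul_add, add_mul, one_mul, mul_one, smul_mul_assoc, mul_smul_comm,
    vecMulVec_mul_vecMulVec, h, one_smul, vecMulVec_add, vecMulVec_smul]
  module

theorem homology_mul_homology_inv {x y : ι → F} (h : y ⬝ᵥ x = 1) {θ : F} (hθ : θ ≠ 0) :
    homology x y θ * homology x y θ⁻¹ = 1 := by
  rw [homology_mul_homology h, ← add_smul, show θ - 1 + θ * (θ⁻¹ - 1) = 0 by field_simp; ring]
  simp

theorem homology_mul_diagonal_mul_homology_apply (x y d : ι → F) (θ φ : F) {k i : ι}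
    (hki : k ≠ i) :
    (homology x y θ * diagonal d * homology x y φ) k i
      = x k * y i * ((θ - 1) * d i + (φ - 1) * d k
        + (θ - 1) * (φ - 1) * ∑ m, x m * y m * d m) := by
  have h1 : (vecMulVec x y * diagonal d) k i = x k * y i * d i := by
    rw [mul_diagonal, vecMulVec_apply]
  have h2 : (diagonal d * vecMulVec x y) k i = d k * (x k * y i) := by
    rw [diagonal_mul, vecMulVec_apply]
  have h3 : (vecMulVec x y * diagonal d * vecMulVec x y) k i
      = x k * y i * ∑ m, x m * y m * d m := by
    rw [mul_apply, Finset.mul_sum]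
    refine Finset.sum_congr rfl fun m _ => ?_
    rw [mul_diagonal, vecMulVec_apply, vecMulVec_apply]
    ring
  simp only [homology, mul_add, add_mul, one_mul, mul_one, smul_mul_assoc, mul_smul_comm,
    Matrix.add_apply, Matrix.smul_apply, smul_eq_mul, h1, h2, h3, diagonal_apply_ne _ hki]
  ring

theorem mul_diagonal_update_mul {A B : Matrix ι ι F} (h : A * B = 1) (l : ι) (θ : F) :
    A * diagonal (Function.update 1 l θ) * B = homology (A.col l) (B.row l) θ := by
  have : diagonal (Function.update 1 l θ) = (1 : Matrix ι ι F) + (θ - 1) • single l l 1 := by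
    ext i j
    by_cases hij : i = j
    · subst hij
      by_cases hi : i = l
      · subst hi; simp
      · simp [hi, Ne.symm hi]
    · simp [hij, single_apply]
      rintro rfl
      simp [hij]
  rw [this, homology, mul_add, add_mul, mul_one, h, mul_smul_comm, smul_mul_assoc]
  congr 2
  ext i j
  simp [mul_apply, single_apply, vecMulVec_apply, ite_and, Finset.sum_ite_eq]

end Homology

/-- A submonoid of matrices which is closed under taking inverses and contains all diagonal
matrices whose determinant is a nonzero `n`-th power. -/
structure IsTorusClosed {n : ℕ} (S : Submonoid (Matrix (Fin n) (Fin n) ℚ)) : Prop where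
  inv_mem : ∀ {A B : Matrix (Fin n) (Fin n) ℚ}, A ∈ S → A * B = 1 → B ∈ S
  diagonal_mem : ∀ {d : Fin n → ℚ} {z : ℚ}, z ≠ 0 → ∏ m, d m = z ^ n → diagonal d ∈ S

namespace IsTorusClosed

variable {n : ℕ} {S : Submonoid (Matrix (Fin n) (Fin n) ℚ)}

theorem diagonal_update_mem (hS : IsTorusClosed S) (l : Fin n) {t : ℚ} (ht : t ≠ 0) :
    diagonal (Function.update 1 l (t ^ n)) ∈ S :=
  hS.diagonal_mem ht (by rw [Finset.prod_update_of_mem (Finset.mem_univ l)]; simp)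

theorem homology_mem (hS : IsTorusClosed S) {A B : Matrix (Fin n) (Fin n) ℚ} (hA : A ∈ S)
    (h : A * B = 1) (l : Fin n) {t : ℚ} (ht : t ≠ 0) :
    homology (A.col l) (B.row l) (t ^ n) ∈ S := by
  rw [← mul_diagonal_update_mul h]
  exact S.mul_mem (S.mul_mem hA (hS.diagonal_update_mem l ht)) (hS.inv_mem hA h)

theorem diagonal_update_mul_inv {l : Fin n} {θ : ℚ} (hθ : θ ≠ 0) :
    diagonal (Function.update 1 l θ) * diagonal (Function.update 1 l θ⁻¹) = 1 := by
  rw [diagonal_mul_diagonal, ← diagonal_one]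
  congr 1
  ext m
  by_cases hm : m = l
  · subst hm; simp [hθ]
  · simp [hm]

theorem exists_transvection_mem_of_apply_eq_zero (hn : 3 ≤ n) (hS : IsTorusClosed S)
    {A B : Matrix (Fin n) (Fin n) ℚ} (hA : A ∈ S) (h : A * B = 1) {i k : Fin n}
    (hAki : A k i = 0) (hBik : B i k ≠ 0) :
    ∃ j l : Fin n, ∃ c : ℚ, j ≠ l ∧ c ≠ 0 ∧ transvection j l c ∈ S := by
  have hn0 : n ≠ 0 := by omega
  have h2 : (2 : ℚ) ^ n ≠ 0 := by positivity
  have h2' : (2 : ℚ) ^ n - 1 ≠ 0 := (sub_pos.2 (one_lt_pow₀ (by norm_num) hn0)).ne'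
  obtain ⟨θ, hθ⟩ : ∃ θ, θ = (2 : ℚ) ^ n := ⟨_, rfl⟩
  rw [← hθ] at h2 h2'
  have hBA : B * A = 1 := mul_eq_one_comm.1 h
  obtain ⟨x, hx⟩ : ∃ x, x = A.col i := ⟨_, rfl⟩
  obtain ⟨y, hy⟩ : ∃ y, y = B.row i := ⟨_, rfl⟩
  have hyx : y ⬝ᵥ x = 1 := by
    have := congr_fun₂ hBA i i
    rw [mul_apply, one_apply_eq] at this
    rwa [hx, hy]
  have hmem : ∀ t : ℚ, t ≠ 0 → homology x y (t ^ n) ∈ S := fun t ht => by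
    rw [hx, hy]; exact hS.homology_mem hA h i ht
  have hxk : x k = 0 := by rw [hx]; exact hAki
  have hyk : y k ≠ 0 := by rw [hy]; exact hBik
  have hmem' : ∀ (l : Fin n) {C : Matrix (Fin n) (Fin n) ℚ}, C ∈ S →
      diagonal (Function.update 1 l θ) * C * diagonal (Function.update 1 l θ⁻¹) ∈ S :=
    fun l C hC => S.mul_mem (S.mul_mem (hθ ▸ hS.diagonal_update_mem l two_ne_zero) hC)
      (by rw [hθ, ← inv_pow]; exact hS.diagonal_update_mem l (by norm_num))
  have key : ∃ c : ℚ, c ≠ 0 ∧ 1 + vecMulVec x (Pi.single k c) ∈ S := by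
    have h1 := S.mul_mem (hmem 2⁻¹ (by norm_num)) (hmem' k (hmem 2 two_ne_zero))
    have h3 : diagonal (Function.update 1 k θ) * homology x y (2 ^ n)
        * diagonal (Function.update 1 k θ⁻¹)
        = homology x (y ᵥ* diagonal (Function.update 1 k θ⁻¹)) θ := by
      rw [homology, homology, ← hθ, mul_add, add_mul, mul_one, diagonal_update_mul_inv h2,
        mul_smul_comm, smul_mul_assoc, mul_vecMulVec, vecMulVec_mul]
      congr 3
      ext m
      rw [mulVec_diagonal]
      by_cases hm : m = k
      · subst hm; simp [hxk]
      · simp [hm]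
    rw [h3, homology_mul_homology hyx, inv_pow, ← hθ] at h1
    refine ⟨(1 - θ⁻¹) * (θ⁻¹ - 1) * y k, ?_, ?_⟩
    · refine mul_ne_zero (mul_ne_zero ?_ ?_) hyk
      · intro h0; apply h2'; field_simp at h0; linarith
      · intro h0; apply h2'; field_simp at h0; linarith
    · convert h1 using 1
      congr 2
      funext m
      simp only [Pi.add_apply, Pi.smul_apply, vecMul_diagonal, smul_eq_mul]
      by_cases hm : m = k
      · subst hm; simp; field_simp; ring
      · simp [hm]; field_simp; ring
  obtain ⟨c, hc, hcS⟩ := key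
  obtain ⟨j, hj⟩ : ∃ j, x j ≠ 0 := by
    by_contra! h0
    rw [dotProduct, Finset.sum_eq_zero (fun m _ => by rw [h0, mul_zero])] at hyx
    exact zero_ne_one hyx
  have hjk : j ≠ k := by rintro rfl; exact hj hxk
  refine ⟨j, k, (θ - 1) * x j * c, hjk, by simp [h2', hj, hc], ?_⟩
  have hinv : (1 + vecMulVec x (Pi.single k c)) * (1 + vecMulVec x (Pi.single k (-c))) = 1 := by
    simp [mul_add, add_mul, vecMulVec_mul_vecMulVec, hxk, add_assoc, ← vecMulVec_add,
      ← Pi.single_add]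
  have h3 := S.mul_mem (hmem' j hcS) (hS.inv_mem hcS hinv)
  have e1 : Pi.single k c ᵥ* diagonal (Function.update 1 j θ⁻¹) = Pi.single k c := by
    funext m
    rw [vecMul_diagonal]
    by_cases hm : m = k
    · subst hm; simp [hjk.symm]
    · simp [hm]
  have e2 : diagonal (Function.update 1 j θ) *ᵥ x = x + Pi.single j ((θ - 1) * x j) := by
    funext m
    rw [mulVec_diagonal]
    by_cases hm : m = j
    · subst hm; simp; ring
    · simp [hm]
  have e3 : diagonal (Function.update 1 j θ) * (1 + vecMulVec x (Pi.single k c))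
      * diagonal (Function.update 1 j θ⁻¹) = 1 + vecMulVec x (Pi.single k c)
        + vecMulVec (Pi.single j ((θ - 1) * x j)) (Pi.single k c) := by
    rw [mul_add, mul_one, add_mul, diagonal_update_mul_inv h2, mul_vecMulVec, vecMulVec_mul, e1,
      e2, add_vecMulVec, add_assoc]
  rw [e3, add_mul, hinv] at h3
  convert h3 using 1
  rw [mul_add, mul_one, vecMulVec_mul_vecMulVec, transvection,
    show single j k ((θ - 1) * x j * c) = vecMulVec (Pi.single j ((θ - 1) * x j)) (Pi.single k c) by
      ext a b
      simp [vecMulVec_apply, single_apply, Pi.single_apply, ite_and, eq_comm]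
      split_ifs <;> rfl]
  simp [hxk]

theorem exists_transvection_mem (hn : 3 ≤ n) (hS : IsTorusClosed S)
    {A B : Matrix (Fin n) (Fin n) ℚ} (hA : A ∈ S) (h : A * B = 1) {l i i' : Fin n}
    (hii' : i ≠ i') (hi : A i l ≠ 0) (hi' : A i' l ≠ 0) :
    ∃ j l : Fin n, ∃ c : ℚ, j ≠ l ∧ c ≠ 0 ∧ transvection j l c ∈ S := by
  have hn0 : n ≠ 0 := by omega
  have hBA : B * A = 1 := mul_eq_one_comm.1 h
  obtain ⟨x, hx⟩ : ∃ x, x = A.col l := ⟨_, rfl⟩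
  obtain ⟨y, hy⟩ : ∃ y, y = B.row l := ⟨_, rfl⟩
  have hyx : y ⬝ᵥ x = 1 := by
    have := congr_fun₂ hBA l l
    rw [mul_apply, one_apply_eq] at this
    rwa [hx, hy]
  have hmem : ∀ t : ℚ, t ≠ 0 → homology x y (t ^ n) ∈ S := fun t ht => by
    rw [hx, hy]; exact hS.homology_mem hA h l ht
  obtain ⟨k, hk⟩ : ∃ k, y k ≠ 0 := by
    by_contra! h0
    rw [dotProduct, Finset.sum_eq_zero (fun m _ => by rw [h0, zero_mul])] at hyx
    exact zero_ne_one hyx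
  obtain ⟨i, hik, hi⟩ : ∃ i, i ≠ k ∧ x i ≠ 0 := by
    by_cases h0 : i = k
    · exact ⟨i', h0 ▸ hii'.symm, by rwa [hx]⟩
    · exact ⟨i, h0, by rwa [hx]⟩
  obtain ⟨t, s, z, d, ht, hs, hz, hd, e1, e2⟩ :=
    exists_torus hn (p := fun m => x m * y m)
      (by rw [← hyx, dotProduct]; exact Finset.sum_congr rfl fun m _ => mul_comm _ _) hik
  have hd0 : ∀ m, d m ≠ 0 := fun m => by
    have : ∏ m, d m ≠ 0 := by rw [hd]; exact pow_ne_zero _ hz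
    exact Finset.prod_ne_zero_iff.1 this m (Finset.mem_univ m)
  have hdd : diagonal d * diagonal (fun m => (d m)⁻¹) = 1 := by
    rw [diagonal_mul_diagonal, ← diagonal_one]
    congr 1
    ext m
    exact mul_inv_cancel₀ (hd0 m)
  refine hS.exists_transvection_mem_of_apply_eq_zero hn (i := i) (k := k)
    (A := homology x y (t ^ n) * diagonal d * homology x y (s ^ n))
    (B := homology x y (s ^ n)⁻¹ * diagonal (fun m => (d m)⁻¹) * homology x y (t ^ n)⁻¹)
    (S.mul_mem (S.mul_mem (hmem t ht) (hS.diagonal_mem hz hd)) (hmem s hs)) ?_ ?_ ?_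
  · calc _ = homology x y (t ^ n) * (diagonal d * (homology x y (s ^ n) *
          homology x y (s ^ n)⁻¹) * diagonal (fun m => (d m)⁻¹)) * homology x y (t ^ n)⁻¹ := by
          simp only [mul_assoc]
      _ = 1 := by
          rw [homology_mul_homology_inv hyx (pow_ne_zero _ hs), mul_one, hdd, mul_one,
            homology_mul_homology_inv hyx (pow_ne_zero _ ht)]
  · rw [homology_mul_diagonal_mul_homology_apply _ _ _ _ _ hik.symm, e1, mul_zero]
  · rw [homology_mul_diagonal_mul_homology_apply _ _ _ _ _ hik]
    exact mul_ne_zero (mul_ne_zero hi hk) e2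

end IsTorusClosed

/-- The matrices of determinant one with exactly one nonzero entry in each row and column. -/
def monomialSubgroup (n : ℕ) : Subgroup (SLQ n) where
  carrier := {g | ∃ σ : Equiv.Perm (Fin n), ∀ i j, g i j ≠ 0 → i = σ j}
  one_mem' := ⟨1, fun i j h => by
    by_contra hij
    exact h (one_apply_ne hij)⟩
  mul_mem' := by
    rintro g h ⟨σ, hσ⟩ ⟨τ, hτ⟩
    refine ⟨σ * τ, fun i j hij => ?_⟩
    rw [Matrix.SpecialLinearGroup.coe_mul, mul_apply] at hij
    obtain ⟨m, -, hm⟩ := Finset.exists_ne_zero_of_sum_ne_zero hij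
    rw [hσ i m (left_ne_zero_of_mul hm), hτ m j (right_ne_zero_of_mul hm), Equiv.Perm.mul_apply]
  inv_mem' := by
    rintro g ⟨σ, hσ⟩
    refine ⟨σ⁻¹, fun i j hij => ?_⟩
    have hgg : (g : Matrix (Fin n) (Fin n) ℚ) * (g⁻¹ : SLQ n) = 1 := by
      rw [← Matrix.SpecialLinearGroup.coe_mul, mul_inv_cancel, Matrix.SpecialLinearGroup.coe_one]
    have hrow : ∀ m, (1 : Matrix (Fin n) (Fin n) ℚ) (σ i) m = g (σ i) i * (g⁻¹ : SLQ n) i m := by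
      intro m
      rw [← hgg, mul_apply]
      refine Finset.sum_eq_single i (fun b _ hb => ?_) (by simp)
      by_contra h0
      exact hb (σ.injective (hσ _ _ (left_ne_zero_of_mul h0))).symm
    have hne : g (σ i) i ≠ 0 := by
      have := hrow (σ i)
      rw [one_apply_eq] at this
      exact left_ne_zero_of_mul (this ▸ one_ne_zero)
    have : (1 : Matrix (Fin n) (Fin n) ℚ) (σ i) j ≠ 0 := by
      rw [hrow j]; exact mul_ne_zero hne hij
    rw [Equiv.Perm.eq_inv_iff_eq]
    by_contra h0
    exact this (one_apply_ne h0)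

theorem exists_apply_ne_zero_row {n : ℕ} (g : SLQ n) (i : Fin n) : ∃ j, g i j ≠ 0 := by
  by_contra! h
  have := det_eq_zero_of_row_eq_zero (A := (g : Matrix (Fin n) (Fin n) ℚ)) i h
  rw [g.det_coe] at this
  exact one_ne_zero this

theorem exists_two_ne_zero_of_notMem_monomialSubgroup {n : ℕ} {g : SLQ n}
    (hg : g ∉ monomialSubgroup n) : ∃ l i i', i ≠ i' ∧ g i l ≠ 0 ∧ g i' l ≠ 0 := by
  by_contra! h
  apply hg
  choose f hf using exists_apply_ne_zero_row g
  have hinj : Function.Injective f := fun a b hab => by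
    by_contra hne
    exact hf b (hab ▸ h (f a) a b hne (hf a))
  let σ := Equiv.ofBijective f hinj.bijective_of_finite
  refine ⟨σ⁻¹, fun i j hij => ?_⟩
  by_contra hne
  refine hij (h j (σ⁻¹ j) i (Ne.symm hne) ?_)
  have := hf (σ⁻¹ j)
  rwa [show f (σ⁻¹ j) = j from σ.apply_symm_apply j] at this

theorem center_le_monomialSubgroup (n : ℕ) : Subgroup.center (SLQ n) ≤ monomialSubgroup n := by
  intro g hg
  obtain ⟨r, -, hr⟩ := Matrix.SpecialLinearGroup.mem_center_iff.1 hg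
  refine ⟨1, fun i j hij => ?_⟩
  by_contra hne
  rw [← hr] at hij
  exact hij (diagonal_apply_ne _ hne)

/-- The nonzero scalar multiples of the elements of a subgroup of `SL(n,ℚ)`. -/
def scalarMultiples {n : ℕ} (H : Subgroup (SLQ n)) : Submonoid (Matrix (Fin n) (Fin n) ℚ) where
  carrier := {A | ∃ r : ℚ, r ≠ 0 ∧ ∃ h ∈ H, A = r • (h : Matrix (Fin n) (Fin n) ℚ)}
  one_mem' := ⟨1, one_ne_zero, 1, H.one_mem, by simp⟩
  mul_mem' := by
    rintro _ _ ⟨r, hr, g, hg, rfl⟩ ⟨s, hs, h, hh, rfl⟩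
    exact ⟨r * s, mul_ne_zero hr hs, g * h, H.mul_mem hg hh, by
      rw [Matrix.SpecialLinearGroup.coe_mul, smul_mul_smul_comm]⟩

theorem coe_mem_scalarMultiples {n : ℕ} {H : Subgroup (SLQ n)} {h : SLQ n} (hh : h ∈ H) :
    (h : Matrix (Fin n) (Fin n) ℚ) ∈ scalarMultiples H :=
  ⟨1, one_ne_zero, h, hh, (one_smul _ _).symm⟩

theorem isTorusClosed_scalarMultiples {n : ℕ} {H : Subgroup (SLQ n)}
    (hH : monomialSubgroup n ≤ H) : IsTorusClosed (scalarMultiples H) where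
  inv_mem := by
    rintro _ B ⟨r, hr, h, hh, rfl⟩ hB
    refine ⟨r⁻¹, inv_ne_zero hr, h⁻¹, H.inv_mem hh, ?_⟩
    have h1 : ((h⁻¹ : SLQ n) : Matrix (Fin n) (Fin n) ℚ) * h = 1 := by
      rw [← Matrix.SpecialLinearGroup.coe_mul, inv_mul_cancel, Matrix.SpecialLinearGroup.coe_one]
    refine (left_inv_eq_right_inv ?_ hB).symm
    rw [smul_mul_smul_comm, inv_mul_cancel₀ hr, h1, one_smul]
  diagonal_mem := by
    intro d z hz hd
    refine ⟨z, hz, ⟨diagonal fun m => z⁻¹ * d m, ?_⟩, hH ⟨1, fun i j hij => ?_⟩, ?_⟩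
    · rw [det_diagonal, Finset.prod_mul_distrib, hd, Finset.prod_const, Finset.card_univ,
        Fintype.card_fin, inv_pow, inv_mul_cancel₀ (pow_ne_zero _ hz)]
    · by_contra hne
      exact hij (diagonal_apply_ne _ hne)
    · ext i j
      by_cases hij : i = j
      · subst hij; simp [hz]
      · simp [hij]

theorem mem_of_coe_mem_scalarMultiples {n : ℕ} {H : Subgroup (SLQ n)}
    (hH : monomialSubgroup n ≤ H) {g : SLQ n}
    (hg : (g : Matrix (Fin n) (Fin n) ℚ) ∈ scalarMultiples H) : g ∈ H := by
  obtain ⟨r, hr, h, hh, hgh⟩ := hg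
  have hr1 : r ^ n = 1 := by
    have := congr_arg det hgh
    rwa [det_smul, g.det_coe, h.det_coe, mul_one, Fintype.card_fin, eq_comm] at this
  rw [← inv_mul_cancel_right g h]
  refine H.mul_mem (hH (center_le_monomialSubgroup n ?_)) hh
  rw [Matrix.SpecialLinearGroup.mem_center_iff]
  refine ⟨r, by simpa using hr1, ?_⟩
  rw [Matrix.SpecialLinearGroup.coe_mul, hgh, smul_mul_assoc, ← Matrix.SpecialLinearGroup.coe_mul,
    mul_inv_cancel, Matrix.SpecialLinearGroup.coe_one]
  ext i j
  simp [Matrix.one_apply, diagonal_apply]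

theorem exists_perm_apply_eq {α : Type*} [DecidableEq α] {j l j' l' : α} (h : j ≠ l)
    (h' : j' ≠ l') : ∃ σ : Equiv.Perm α, σ j = j' ∧ σ l = l' := by
  refine ⟨Equiv.swap (Equiv.swap j j' l) l' * Equiv.swap j j', ?_, ?_⟩
  · rw [Equiv.Perm.mul_apply, Equiv.swap_apply_left]
    refine Equiv.swap_apply_of_ne_of_ne (fun h0 => h ?_) h'
    rw [Equiv.swap_apply_def] at h0
    split_ifs at h0 <;> simp_all
  · rw [Equiv.Perm.mul_apply, Equiv.swap_apply_left]

theorem transvection_mem_scalarMultiples {n : ℕ} (hn : 3 ≤ n) {H : Subgroup (SLQ n)}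
    (hH : monomialSubgroup n ≤ H) {j l : Fin n} {c : ℚ} (hjl : j ≠ l) (hc : c ≠ 0)
    (hT : transvection j l c ∈ scalarMultiples H) {j' l' : Fin n} (hjl' : j' ≠ l') (c' : ℚ) :
    transvection j' l' c' ∈ scalarMultiples H := by
  by_cases hc' : c' = 0
  · subst hc'
    rw [transvection_zero]
    exact one_mem _
  obtain ⟨σ, rfl, rfl⟩ := exists_perm_apply_eq hjl hjl'
  obtain ⟨m, hmj, hml⟩ := exists_fin_ne_ne hn (σ j) (σ l)
  let ε : ℚ := (Equiv.Perm.sign σ⁻¹ : ℤ)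
  have hε : ε * ε = 1 := by
    rw [← Int.cast_mul, ← Units.val_mul, Int.units_mul_self]
    simp
  let d : Fin n → ℚ := fun a => if a = σ j then c' / c else if a = σ l then 1 else
    if a = m then ε * (c / c') else 1
  have hd : ∏ a, d a = ε := by
    rw [prod_eq_mul_mul_of_ne hjl' hmj.symm hml.symm d
      (fun a h1 h2 h3 => by simp [d, h1, h2, h3])]
    simp only [d, if_true, hjl'.symm, hmj, hml, if_false]
    field_simp
  let W : SLQ n := ⟨diagonal d * σ⁻¹.permMatrix ℚ, by
    rw [det_mul, det_diagonal, det_permutation, hd, hε]⟩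
  have hWapp : ∀ a b, W a b = if σ⁻¹ a = b then d a else 0 := fun a b => by
    simp [W, diagonal_mul, PEquiv.toMatrix_apply, Equiv.toPEquiv_apply]
  have hW : W ∈ H := hH ⟨σ, fun a b hab => by
    rw [hWapp] at hab
    by_contra hne
    exact hab (if_neg fun h0 => hne (by rw [← h0]; simp))⟩
  have hWT : (W : Matrix (Fin n) (Fin n) ℚ) * transvection j l c
      = transvection (σ j) (σ l) c' * W := by
    rw [transvection, transvection, mul_add, add_mul, mul_one, one_mul]
    congr 1
    ext a b
    rw [mul_apply, mul_apply]
    simp only [single_apply, hWapp, ite_and, mul_ite, ite_mul, mul_zero, zero_mul,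
      Finset.sum_ite_eq, Finset.sum_ite_eq', Finset.mem_univ, if_true, Equiv.Perm.inv_eq_iff_eq,
      σ.injective.eq_iff]
    by_cases hlb : l = b
    · subst hlb
      by_cases haj : a = σ j
      · simp [d, haj, hjl'.symm, hc]
      · simp [haj, Ne.symm haj]
    · simp [hlb]
  have hWinv : (W : Matrix (Fin n) (Fin n) ℚ) * (W⁻¹ : SLQ n) = 1 := by
    rw [← Matrix.SpecialLinearGroup.coe_mul, mul_inv_cancel, Matrix.SpecialLinearGroup.coe_one]
  rw [← mul_one (transvection (σ j) (σ l) c'), ← hWinv, ← mul_assoc, ← hWT]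
  exact mul_mem (mul_mem (coe_mem_scalarMultiples hW) hT)
    (coe_mem_scalarMultiples (H.inv_mem hW))

theorem eq_top_of_monomialSubgroup_lt {n : ℕ} (hn : 3 ≤ n) {H : Subgroup (SLQ n)}
    (hH : monomialSubgroup n < H) : H = ⊤ := by
  obtain ⟨h, hh, hhM⟩ := SetLike.exists_of_lt hH
  obtain ⟨l, i, i', hii', hi, hi'⟩ := exists_two_ne_zero_of_notMem_monomialSubgroup hhM
  have hS := isTorusClosed_scalarMultiples hH.le
  obtain ⟨j, k, c, hjk, hc, hT⟩ := hS.exists_transvection_mem hn (coe_mem_scalarMultiples hh)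
    (B := (h⁻¹ : SLQ n))
    (by rw [← Matrix.SpecialLinearGroup.coe_mul, mul_inv_cancel, Matrix.SpecialLinearGroup.coe_one])
    hii' hi hi'
  have hall : ∀ L : List (TransvectionStruct (Fin n) ℚ),
      (L.map TransvectionStruct.toMatrix).prod ∈ scalarMultiples H := fun L => by
    refine list_prod_mem fun A hA => ?_
    obtain ⟨t, -, rfl⟩ := List.mem_map.1 hA
    exact transvection_mem_scalarMultiples hn hH.le hjk hc hT t.hij t.c
  rw [eq_top_iff]
  intro g _
  apply mem_of_coe_mem_scalarMultiples hH.le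
  obtain ⟨L, L', D, hg⟩ := Pivot.exists_list_transvec_mul_diagonal_mul_list_transvec
    (g : Matrix (Fin n) (Fin n) ℚ)
  have hD : ∏ m, D m = 1 ^ n := by
    have := congr_arg det hg
    rw [g.det_coe, det_mul, det_mul, TransvectionStruct.det_toMatrix_prod,
      TransvectionStruct.det_toMatrix_prod, det_diagonal] at this
    rw [one_pow, this]
    ring
  rw [hg]
  exact mul_mem (mul_mem (hall L) (hS.diagonal_mem one_ne_zero hD)) (hall L')

/-- The unipotent upper triangular Jordan block. -/
def jordanBlock (n : ℕ) : SLQ n :=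
  ⟨of fun i j => if i = j ∨ (i : ℕ) + 1 = j then 1 else 0, by
    rw [det_of_isUpperTriangular]
    · simp
    · intro i j hij
      simp only [id] at hij
      rw [of_apply, if_neg]
      rintro (rfl | h)
      · exact lt_irrefl _ hij
      · have : (j : ℕ) < i := hij
        omega⟩

theorem jordanBlock_apply_ne_zero {n : ℕ} {i j : Fin n} :
    jordanBlock n i j ≠ 0 ↔ i = j ∨ (i : ℕ) + 1 = j := by
  simp [jordanBlock, or_iff_not_imp_left]

theorem jordanBlock_apply_of_ne_zero {n : ℕ} {i j : Fin n} (h : jordanBlock n i j ≠ 0) :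
    jordanBlock n i j = 1 := by
  rw [jordanBlock_apply_ne_zero] at h
  simp [jordanBlock, h]

theorem mem_center_of_mul_jordanBlock_eq {n : ℕ} {g h : SLQ n} (hg : g ∈ monomialSubgroup n)
    (hh : h ∈ monomialSubgroup n) (hgh : g * jordanBlock n = jordanBlock n * h) :
    g ∈ Subgroup.center (SLQ n) := by
  obtain ⟨σ, hσ⟩ := hg
  obtain ⟨τ, hτ⟩ := hh
  have hσ0 : ∀ m, g (σ m) m ≠ 0 := fun m => by
    obtain ⟨j, hj⟩ := exists_apply_ne_zero_row g (σ m)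
    rwa [← σ.injective (hσ _ _ hj)] at hj
  have hτ0 : ∀ m, h (τ m) m ≠ 0 := fun m => by
    obtain ⟨j, hj⟩ := exists_apply_ne_zero_row h (τ m)
    rwa [← τ.injective (hτ _ _ hj)] at hj
  have key : ∀ a b, g (σ a) a * jordanBlock n a b = jordanBlock n (σ a) (τ b) * h (τ b) b := by
    intro a b
    have := congr_arg (fun A : SLQ n => A (σ a) b) hgh
    simp only [Matrix.SpecialLinearGroup.coe_mul, mul_apply] at this
    rwa [Finset.sum_eq_single a, Finset.sum_eq_single (τ b)] at this
    · intro m _ hm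
      by_contra h0
      exact hm (hτ _ _ (right_ne_zero_of_mul h0))
    · simp
    · intro m _ hm
      by_contra h0
      exact hm (σ.injective (hσ _ _ (left_ne_zero_of_mul h0))).symm
    · simp
  have hiff : ∀ a b : Fin n, (a = b ∨ (a : ℕ) + 1 = b) ↔ (σ a = τ b ∨ (σ a : ℕ) + 1 = τ b) := by
    intro a b
    rw [← jordanBlock_apply_ne_zero, ← jordanBlock_apply_ne_zero]
    have := key a b
    constructor
    · intro h1 h2
      rw [h2, zero_mul] at this
      exact mul_ne_zero (hσ0 a) h1 this
    · intro h1 h2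
      rw [h2, mul_zero] at this
      exact mul_ne_zero h1 (hτ0 b) this.symm
  have hfix : ∀ m (hm : m < n), σ ⟨m, hm⟩ = ⟨m, hm⟩ ∧ τ ⟨m, hm⟩ = ⟨m, hm⟩ := by
    intro m
    induction m with
    | zero =>
      intro hm
      have hτm : τ ⟨0, hm⟩ = ⟨0, hm⟩ := by
        by_contra hne
        have hpos : 0 < (τ ⟨0, hm⟩ : ℕ) := Nat.pos_of_ne_zero fun h0 => hne (Fin.ext h0)
        have h1 := (hiff (σ⁻¹ (τ ⟨0, hm⟩)) ⟨0, hm⟩).2 (Or.inl (by simp))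
        have h2 := (hiff (σ⁻¹ ⟨τ ⟨0, hm⟩ - 1, by omega⟩) ⟨0, hm⟩).2
          (Or.inr (by simp; omega))
        have h3 : σ⁻¹ (τ ⟨0, hm⟩) = σ⁻¹ ⟨τ ⟨0, hm⟩ - 1, by omega⟩ := by
          rw [h1.resolve_right (by simp), h2.resolve_right (by simp)]
        have h4 := congr_arg Fin.val (σ⁻¹.injective h3)
        simp only at h4
        omega
      have h1 := (hiff ⟨0, hm⟩ ⟨0, hm⟩).1 (Or.inl rfl)
      rw [hτm] at h1
      exact ⟨h1.resolve_right (by simp), hτm⟩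
    | succ m ih =>
      intro hm
      obtain ⟨hσm, hτm⟩ := ih (by omega)
      have hτs : τ ⟨m + 1, hm⟩ = ⟨m + 1, hm⟩ := by
        have h1 := (hiff ⟨m, by omega⟩ ⟨m + 1, hm⟩).1 (Or.inr rfl)
        rw [hσm] at h1
        rcases h1 with h1 | h1
        · have h2 := congr_arg Fin.val (τ.injective (hτm.trans h1))
          simp at h2
        · exact Fin.ext h1.symm
      have h1 := (hiff ⟨m + 1, hm⟩ ⟨m + 1, hm⟩).1 (Or.inl rfl)
      rw [hτs] at h1
      refine ⟨h1.resolve_right fun h2 => ?_, hτs⟩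
      have h3 : σ ⟨m + 1, hm⟩ = σ ⟨m, by omega⟩ := by
        rw [hσm]; exact Fin.ext (by simpa using h2)
      have h4 := congr_arg Fin.val (σ.injective h3)
      simp at h4
  have hσ1 : ∀ a, σ a = a := fun a => (hfix a a.2).1
  have hτ1 : ∀ a, τ a = a := fun a => (hfix a a.2).2
  simp only [hσ1, hτ1] at key hσ
  have hval : ∀ a b : Fin n, (a = b ∨ (a : ℕ) + 1 = b) → g a a = h b b := fun a b hab => by
    have h1 := jordanBlock_apply_of_ne_zero (jordanBlock_apply_ne_zero.2 hab)
    simpa [h1] using key a b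
  have hconst : ∀ m (hm : m < n), g ⟨m, hm⟩ ⟨m, hm⟩ = g ⟨0, by omega⟩ ⟨0, by omega⟩ := by
    intro m
    induction m with
    | zero => intro _; rfl
    | succ m ih =>
      intro hm
      rw [← ih (by omega), hval ⟨m, by omega⟩ ⟨m + 1, hm⟩ (Or.inr rfl), hval _ _ (Or.inl rfl)]
  rcases Nat.eq_zero_or_pos n with rfl | hn
  · have : g = 1 := by ext i; exact i.elim0
    rw [this]; exact one_mem _
  have hscalar : scalar (Fin n) (g ⟨0, hn⟩ ⟨0, hn⟩) = (g : Matrix (Fin n) (Fin n) ℚ) := by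
    ext a b
    by_cases hab : a = b
    · subst hab
      simpa using (hconst a a.2).symm
    · rw [scalar_apply, diagonal_apply_ne _ hab]
      by_contra h0
      exact hab (hσ _ _ (Ne.symm h0))
  refine Matrix.SpecialLinearGroup.mem_center_iff.2 ⟨_, ?_, hscalar⟩
  have := congr_arg det hscalar
  rwa [g.det_coe, scalar_apply, det_diagonal, Finset.prod_const, Finset.card_univ] at this

theorem infinite_PSLQ {n : ℕ} (hn : 3 ≤ n) : Infinite (PSLQ n) := by
  let i : Fin n := ⟨0, by omega⟩
  let j : Fin n := ⟨1, by omega⟩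
  have hij : i ≠ j := by simp [i, j]
  let T : ℚ → SLQ n := fun c => ⟨transvection i j c, det_transvection_of_ne i j hij c⟩
  refine Infinite.of_injective (fun c => (QuotientGroup.mk (T c) : PSLQ n)) ?_
  intro a b hab
  replace hab := QuotientGroup.eq.1 hab
  obtain ⟨r, -, hr⟩ := Matrix.SpecialLinearGroup.mem_center_iff.1 hab
  have h1 : (transvection i j a : Matrix (Fin n) (Fin n) ℚ) * scalar (Fin n) r
      = transvection i j b := by
    rw [hr]
    exact congr_arg Subtype.val (mul_inv_cancel_left (T a) (T b))
  have h2 := congr_fun₂ h1 i i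
  have h3 := congr_fun₂ h1 i j
  simp [transvection, hij, hij.symm] at h2 h3
  simpa [h2] using h3

/-- The `SL(n,ℚ)` version of Theorem 3: for `n ≥ 3` there exist an infinite-index
maximal subgroup `M` of `PSL(n,ℚ)` and `g ∈ PSL(n,ℚ)` with `M ∩ gMg⁻¹ = {id}`. -/
theorem exists_maximal_subgroup_trivial_conj_intersection_rat (n : ℕ) (hn : 3 ≤ n) :
    ∃ (M : Subgroup (PSLQ n)) (g : PSLQ n), IsMaxSubgroup M ∧ M.index = 0 ∧
      M ⊓ Subgroup.map (MulAut.conj g).toMonoidHom M = ⊥ := by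
  have hinf := infinite_PSLQ hn
  let π := QuotientGroup.mk' (Subgroup.center (SLQ n))
  have hπ : Function.Surjective π := QuotientGroup.mk'_surjective _
  let M := (monomialSubgroup n).map π
  have hcomap : M.comap π = monomialSubgroup n := by
    rw [QuotientGroup.comap_map_mk', sup_eq_right]
    exact center_le_monomialSubgroup n
  have hbot : M ⊓ Subgroup.map (MulAut.conj (π (jordanBlock n))).toMonoidHom M = ⊥ := by
    rw [eq_bot_iff]
    rintro _ ⟨⟨g, hg, rfl⟩, ⟨_, ⟨h, hh, rfl⟩, hgh⟩⟩
    rw [MulEquiv.coe_toMonoidHom, MulAut.conj_apply, ← map_inv, ← map_mul, ← map_mul] at hgh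
    obtain ⟨z, hz, hgz⟩ := (QuotientGroup.mk'_eq_mk' _).1 hgh
    rw [Subgroup.mem_bot]
    refine (QuotientGroup.eq_one_iff g).2 (mem_center_of_mul_jordanBlock_eq hg
      (mul_mem hh (center_le_monomialSubgroup n hz)) ?_)
    rw [← hgz, mul_assoc, ← Subgroup.mem_center_iff.1 hz]
    group
  have hindex : M.index = 0 := by
    by_contra hM
    have hM' : (Subgroup.map (MulAut.conj (π (jordanBlock n))).toMonoidHom M).index ≠ 0 := by
      exact fun h =>
        hM ((Subgroup.index_map_equiv M (MulAut.conj (π (jordanBlock n)))).symm.trans h)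
    have := Subgroup.index_inf_ne_zero hM hM'
    rw [hbot, Subgroup.index_bot] at this
    exact this Nat.card_eq_zero_of_infinite
  refine ⟨M, π (jordanBlock n), ⟨?_, fun K hK => ?_⟩, hindex, hbot⟩
  · intro h
    rw [h, Subgroup.index_top] at hindex
    exact one_ne_zero hindex
  · have hlt : monomialSubgroup n < K.comap π := by
      rw [← hcomap]
      exact (Subgroup.comap_lt_comap_of_surjective hπ).2 hK
    rw [← Subgroup.map_comap_eq_self_of_surjective hπ K, eq_top_of_monomialSubgroup_lt hn hlt,
      Subgroup.map_top_of_surjective π hπ]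
end
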